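/- arXiv:2506.16271 — 3 statements merged into one kernel-verified Lean document; each statement's English description precedes it below -/
import Mathlib

section
/- Let q ≥ 3 be a prime power, I an index set, η ∈ F_{q^2} with η^{q+1} = 1. Let Π be a parallelism of Σ_η such that D_η ∈ Π and every member of Π other than D_η has the form (S_ℓ \ R_ℓ) ∪ R_ℓ^o for some line ℓ of PG(3,q^2) with ℓ ∩ τ_η(ℓ) = ∅ and ℓ ∩ Σ_η = ∅, where R_ℓ = D_η ∩ S_ℓ is a regulus of Σ_η containing the line r_{U_1} ∩ Σ_η. If Π is invariant under every projectivity g_b, b ∈ F_{q^2} (i.e. { {g_b(m) : m ∈ S} : S ∈ Π } = Π for all b), then there exists a good set 𝒫 such that Π = Π_𝒫. -/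
open Projectivization Classical

noncomputable section

abbrev Pt (F : Type) [Field F] := Projectivization F (Fin 4 → F)

variable (q : ℕ) (F : Type) [Field F]

/-- The line `t₁ = {(x₁, x₂, 0, 0)}` of `PG(3, q²)`. -/
def t1 : Set (Pt F) := {P | P.rep 2 = 0 ∧ P.rep 3 = 0}

/-- The line `t₂ = {(0, 0, x₃, x₄)}` of `PG(3, q²)`. -/
def t2 : Set (Pt F) := {P | P.rep 0 = 0 ∧ P.rep 1 = 0}

/-- The line `r_{U₁} = {(x₁, 0, x₃, 0)}` of `PG(3, q²)`. -/
def rU1 : Set (Pt F) := {P | P.rep 1 = 0 ∧ P.rep 3 = 0}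

/-- The Baer subgeometry `Σ_α = {(x, y, α xᑫ, α yᑫ)}`. -/
def SigmaSet (α : F) : Set (Pt F) :=
  {P | ∃ (x y : F) (h : ![x, y, α * x ^ q, α * y ^ q] ≠ 0),
    P = Projectivization.mk F ![x, y, α * x ^ q, α * y ^ q] h}

def tauFun (α : F) (v : Fin 4 → F) : Fin 4 → F :=
  ![(v 2) ^ q, (v 3) ^ q, α ^ (q + 1) * (v 0) ^ q, α ^ (q + 1) * (v 1) ^ q]

/-- The collineation `τ_α : (x₁,x₂,x₃,x₄) ↦ (x₃ᑫ, x₄ᑫ, α^{q+1} x₁ᑫ, α^{q+1} x₂ᑫ)`. -/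
def tau (α : F) (P : Pt F) : Pt F :=
  if h : tauFun q F α P.rep ≠ 0 then Projectivization.mk F _ h else P

/-- `s` is (the point set of) a line of `PG(3, q²)`. -/
def isLine (s : Set (Pt F)) : Prop :=
  ∃ W : Submodule F (Fin 4 → F), Module.finrank F W = 2 ∧
    s = {P : Pt F | P.submodule ≤ W}

/-- `s` is (the point set of) a plane of `PG(3, q²)`. -/
def isPlane (s : Set (Pt F)) : Prop :=
  ∃ W : Submodule F (Fin 4 → F), Module.finrank F W = 3 ∧
    s = {P : Pt F | P.submodule ≤ W}

/-- The set of points of the line (or point) spanned by `A` and `B`. -/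
def lineThrough (A B : Pt F) : Set (Pt F) :=
  {P : Pt F | P.submodule ≤ A.submodule ⊔ B.submodule}

/-- For `P = (a, b, 0, 0) ∈ t₁`, `rLine P` is the line through `(a,b,0,0)` and `(0,0,aᑫ,bᑫ)`. -/
def rLine (P : Pt F) : Set (Pt F) := lineThrough F P (tau q F 1 P)

/-- The Desarguesian line-spread `D_α = { r_P ∩ Σ_α : P ∈ t₁ }`. -/
def Dspread (α : F) : Set (Set (Pt F)) :=
  {s | ∃ P ∈ t1 F, s = rLine q F P ∩ SigmaSet q F α}

/-- `U = { u : u^{q+1} = 1 }`. -/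
def Uset : Set F := {u : F | u ^ (q + 1) = 1}

/-- The subfield `F_q` of `F_{q²}`, as a set. -/
def FqSet : Set F := {x : F | x ^ q = x}

/-- The norm image `N = { α^{q+1} : α ∈ I }`. -/
def normIm (I : Set F) : Set F := (fun α : F => α ^ (q + 1)) '' I

/-- `I` is an index set. -/
def IsIndexSet (I : Set F) : Prop :=
  (0 : F) ∉ I ∧
  Set.InjOn (fun α : F => α ^ (q + 1)) I ∧
  (∀ a ∈ normIm q F I, a ∈ FqSet q F) ∧
  (1 : F) ∉ normIm q F I ∧
  normIm q F I ∪ Inv.inv '' normIm q F I ∪ {1} = FqSet q F \ {0} ∧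
  (Even q → normIm q F I ∩ Inv.inv '' normIm q F I = ∅) ∧
  (Odd q → normIm q F I ∩ Inv.inv '' normIm q F I = {-1} ∧
    normIm q F I ∩ Neg.neg '' normIm q F I = ∅)

lemma vec4_ne_zero_fst (a b c d : F) (ha : a ≠ 0) : ![a, b, c, d] ≠ 0 := by
  intro h
  exact ha (by simpa using congrFun h 0)

/-- The point `P_{αu} = (1, 0, αu, 0)`. -/
def Ppt (α u : F) : Pt F :=
  Projectivization.mk F ![1, 0, α * u, 0] (vec4_ne_zero_fst F 1 0 (α * u) 0 one_ne_zero)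

/-- The plane `π_{αv} : X₄ = α v X₂`. -/
def planeSet (α v : F) : Set (Pt F) := {P | P.rep 3 = α * v * P.rep 1}

/-- The Baer subpencil `p(P_{αu}, π_{αv})`: the lines through `P_{αu}` contained in `π_{αv}`
meeting `Σ_α` in `q+1` points. -/
def pencil (α u v : F) : Set (Set (Pt F)) :=
  {ℓ | isLine F ℓ ∧ Ppt F α u ∈ ℓ ∧ ℓ ⊆ planeSet F α v ∧ (ℓ ∩ SigmaSet q F α).ncard = q + 1}

/-- `m` is a line of the Baer subgeometry `Σ_η`. -/
def IsLineOfSigma (η : F) (m : Set (Pt F)) : Prop :=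
  ∃ s : Set (Pt F), isLine F s ∧ m = s ∩ SigmaSet q F η ∧ m.ncard = q + 1

/-- `S` is a line-spread of `Σ_η`. -/
def IsSpreadOfSigma (η : F) (S : Set (Set (Pt F))) : Prop :=
  (∀ m ∈ S, IsLineOfSigma q F η m) ∧
  (∀ m ∈ S, ∀ m' ∈ S, m ≠ m' → m ∩ m' = ∅) ∧
  ⋃₀ S = SigmaSet q F η

/-- `Pl` is a parallelism of `Σ_η`. -/
def IsParallelismOfSigma (η : F) (Pl : Set (Set (Set (Pt F)))) : Prop :=
  (∀ S ∈ Pl, IsSpreadOfSigma q F η S) ∧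
  ∀ m : Set (Pt F), IsLineOfSigma q F η m → ∃! S, S ∈ Pl ∧ m ∈ S

/-- `R` is a regulus of `Σ_η`. -/
def IsRegulusOfSigma (η : F) (R : Set (Set (Pt F))) : Prop :=
  ∃ m1 m2 m3 : Set (Pt F),
    IsLineOfSigma q F η m1 ∧ IsLineOfSigma q F η m2 ∧ IsLineOfSigma q F η m3 ∧
    m1 ∩ m2 = ∅ ∧ m1 ∩ m3 = ∅ ∧ m2 ∩ m3 = ∅ ∧
    R = {m | IsLineOfSigma q F η m ∧
      (m ∩ m1).Nonempty ∧ (m ∩ m2).Nonempty ∧ (m ∩ m3).Nonempty}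

/-- `S_ℓ = { ⟨Q, τ_η(Q)⟩ ∩ Σ_η : Q ∈ ℓ }`. -/
def Sspread (η : F) (ℓ : Set (Pt F)) : Set (Set (Pt F)) :=
  {m | ∃ Q ∈ ℓ, m = lineThrough F Q (tau q F η Q) ∩ SigmaSet q F η}

/-- `R_ℓ = D_η ∩ S_ℓ`. -/
def Rreg (η : F) (ℓ : Set (Pt F)) : Set (Set (Pt F)) :=
  Dspread q F η ∩ Sspread q F η ℓ

/-- `R_ℓᵒ`: the set of lines of `Σ_η` meeting every line of `R_ℓ`. -/
def Ropp (η : F) (ℓ : Set (Pt F)) : Set (Set (Pt F)) :=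
  {m | IsLineOfSigma q F η m ∧ ∀ m' ∈ Rreg q F η ℓ, (m ∩ m').Nonempty}

/-- `G` is a good set (relative to the index set `I`). -/
def IsGoodSet (I : Set F) (G : Finset (F × F × F)) : Prop :=
  G.card = q + 1 ∧
  (∀ t ∈ G, t.1 ∈ I ∧ t.2.1 ∈ Uset q F ∧ t.2.2 ∈ Uset q F) ∧
  ∀ t ∈ G, ∀ t' ∈ G, t ≠ t' →
    t.2.1 * t'.2.2 - t'.2.1 * t.2.2 ≠ 0 ∧
    t.1 * t.2.1 * (t'.1 * t'.2.2) ^ q - (t.1 * t.2.2) ^ q * (t'.1 * t'.2.1) ≠ 0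

/-- `L_G = ⋃_{(α,u,v) ∈ G} ( p(P_{αu}, π_{αv}) \ {r_{U₁}} )`. -/
def Lset (G : Finset (F × F × F)) : Set (Set (Pt F)) :=
  ⋃ t ∈ G, (pencil q F t.1 t.2.1 t.2.2 \ {rU1 F})

/-- The putative parallelism `Π_G` associated with `G`. -/
def ParP (η : F) (G : Finset (F × F × F)) : Set (Set (Set (Pt F))) :=
  {S | ∃ ℓ ∈ Lset q F G, S = (Sspread q F η ℓ \ Rreg q F η ℓ) ∪ Ropp q F η ℓ}
    ∪ {Dspread q F η}

def gFun (b : F) (v : Fin 4 → F) : Fin 4 → F :=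
  ![v 0 + b * v 1, v 1, v 2 + b ^ q * v 3, v 3]

/-- The projectivity `g_b : (x₁,x₂,x₃,x₄) ↦ (x₁ + b x₂, x₂, x₃ + bᑫ x₄, x₄)`. -/
def gmap (b : F) (P : Pt F) : Pt F :=
  if h : gFun q F b P.rep ≠ 0 then Projectivization.mk F _ h else P

end

/-- The `q`-th power map is a nontrivial involutory field automorphism of `F` with `q` fixed points
and `q + 1` elements of norm one. -/
structure QFrob (q : ℕ) (F : Type) [Field F] : Prop where
  ne_zero : q ≠ 0
  add (x y : F) : (x + y) ^ q = x ^ q + y ^ q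
  invol (x : F) : (x ^ q) ^ q = x
  exists_not_fixed : ∃ g : F, g ^ q ≠ g
  ncard_fixed : {x : F | x ^ q = x}.ncard = q
  ncard_norm_one : {x : F | x ^ (q + 1) = 1}.ncard = q + 1

lemma ncard_pow_eq_one {F : Type} [Field F] [Fintype F] {n : ℕ} (hn : n ≠ 0)
    (h : n ∣ Fintype.card F - 1) : {x : F | x ^ n = 1}.ncard = n := by
  have h1 := IsCyclic.card_powMonoidHom_ker (G := Fˣ) n
  rw [Nat.card_units, Nat.card_eq_fintype_card (α := F), Nat.gcd_eq_right h] at h1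
  rw [← Nat.card_coe_set_eq]
  refine Eq.trans (Nat.card_congr ?_) h1
  exact
    { toFun := fun x => ⟨(Units.mk0 x.1 (fun h0 => by
        have := x.2
        simp [h0, hn] at this)), by
          rw [MonoidHom.mem_ker]
          ext
          exact x.2⟩
      invFun := fun u => ⟨(u.1 : F), by
        have := u.2
        rw [MonoidHom.mem_ker] at this
        simpa using congrArg Units.val this⟩
      left_inv := fun x => by simp
      right_inv := fun u => by ext; simp }

lemma qFrob_of_card {q : ℕ} (hq : IsPrimePow q) {F : Type} [Field F] [Fintype F]
    (hF : Fintype.card F = q ^ 2) : QFrob q F := by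
  obtain ⟨p, k, hp, hk, rfl⟩ := hq
  have hp' : p.Prime := hp.nat_prime
  have : Fact p.Prime := ⟨hp'⟩
  have : CharP F p := by
    refine charP_of_card_eq_prime_pow (f := k * 2) ?_
    rw [hF, pow_mul]
  have h1 : 1 < p ^ k := Nat.one_lt_pow hk.ne' hp'.one_lt
  set q := p ^ k with hqdef
  obtain ⟨r, hr⟩ : ∃ r, q = r + 2 := ⟨q - 2, by omega⟩
  have hU : {x : F | x ^ (q + 1) = 1}.ncard = q + 1 := by
    refine ncard_pow_eq_one (by omega) ⟨q - 1, ?_⟩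
    rw [hF, hr]
    simp only [Nat.add_succ_sub_one]
    ring_nf
    omega
  have hfix : {x : F | x ^ q = x}.ncard = q := by
    have h2 : {x : F | x ^ q = x} = insert 0 {x : F | x ^ (q - 1) = 1} := by
      ext x
      simp only [Set.mem_ofPred_eq, Set.mem_insert_iff]
      by_cases hx : x = 0
      · simp [hx, show q ≠ 0 by omega]
      · have : x ^ q = x * x ^ (q - 1) := by
          rw [← pow_succ']
          congr 1
          omega
        rw [this]
        simp [hx]
    rw [h2, Set.ncard_insert_of_notMem (by simp [show q - 1 ≠ 0 by omega]),
      ncard_pow_eq_one (by omega) ⟨q + 1, by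
        rw [hF, hr]
        simp only [Nat.add_succ_sub_one]
        ring_nf
        omega⟩]
    omega
  refine ⟨by omega, fun x y => ?_, fun x => ?_, ?_, hfix, hU⟩
  · exact add_pow_char_pow x y p k
  · rw [← pow_mul, ← sq, ← hF, FiniteField.pow_card]
  · by_contra! h
    have : {x : F | x ^ q = x} = Set.univ := by
      ext x
      simp [h x]
    rw [this, Set.ncard_univ, Nat.card_eq_fintype_card, hF] at hfix
    nlinarith

namespace QFrob

variable {q : ℕ} {F : Type} [Field F]

lemma sub (hf : QFrob q F) (x y : F) : (x - y) ^ q = x ^ q - y ^ q := by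
  have := hf.add (x - y) y
  rw [sub_add_cancel] at this
  rw [this]
  ring

lemma zero_pow (hf : QFrob q F) : (0 : F) ^ q = 0 := by
  simp [hf.ne_zero]

lemma inj (hf : QFrob q F) {x y : F} (h : x ^ q = y ^ q) : x = y := by
  rw [← hf.invol x, h, hf.invol]

/-- The polynomial `a X + b X ^ q` vanishes on `F` only if it is zero. -/
lemma coeff_eq_zero (hf : QFrob q F) {a b : F} (h : ∀ x : F, a * x + b * x ^ q = 0) :
    a = 0 ∧ b = 0 := by
  obtain ⟨g, hg⟩ := hf.exists_not_fixed
  have h1 := h 1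
  have h2 := h g
  rw [one_pow] at h1
  have h3 : b * (g ^ q - g) = 0 := by linear_combination h2 - g * h1
  have hb : b = 0 := (mul_eq_zero.mp h3).resolve_right (sub_ne_zero.mpr hg)
  refine ⟨?_, hb⟩
  simpa [hb] using h1

/-- Hilbert 90. -/
lemma exists_eq_mul_pow (hf : QFrob q F) {w : F} (hw : w ^ (q + 1) = 1) :
    ∃ d : F, d ≠ 0 ∧ d = w * d ^ q := by
  by_contra! h
  have key : ∀ x : F, 1 * x + w * x ^ q = 0 := by
    intro x
    by_contra hx
    apply h _ hx
    rw [hf.add, mul_pow, mul_pow, hf.invol, one_pow]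
    linear_combination (-x) * hw
  exact one_ne_zero (hf.coeff_eq_zero key).1

lemma ncard_eq_mul_pow (hf : QFrob q F) {w : F} (hw : w ^ (q + 1) = 1) :
    {x : F | x = w * x ^ q}.ncard = q := by
  obtain ⟨d, hd, hdw⟩ := hf.exists_eq_mul_pow hw
  refine Eq.trans ?_ hf.ncard_fixed
  refine (Set.ncard_image_of_injective (f := fun x => x / d) _ (fun x y h => by
    simpa [div_left_inj' hd] using h)).symm.trans (congrArg _ ?_)
  have hd' : d ^ q ≠ 0 := pow_ne_zero _ hd
  have hw0 : w ≠ 0 := fun h => hd (by rw [hdw, h, zero_mul])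
  ext y
  simp only [Set.mem_image, Set.mem_ofPred_eq]
  constructor
  · rintro ⟨x, hx, rfl⟩
    rw [div_pow, div_eq_div_iff hd' hd]
    apply mul_left_cancel₀ hw0
    linear_combination x * hdw - d * hx
  · intro hy
    refine ⟨y * d, ?_, mul_div_cancel_right₀ _ hd⟩
    rw [mul_pow, hy]
    linear_combination y * hdw

/-- Two solutions of `x = w x ^ q` have a ratio fixed by the `q`-th power map. -/
lemma div_fixed {w d t : F} (hd : d ≠ 0) (hdw : d = w * d ^ q) (ht : t = w * t ^ q) :
    (t / d) ^ q = t / d := by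
  have hd' : d ^ q ≠ 0 := pow_ne_zero _ hd
  have hw0 : w ≠ 0 := fun h => hd (by rw [hdw, h, zero_mul])
  rw [div_pow, div_eq_div_iff hd' hd]
  apply mul_left_cancel₀ hw0
  linear_combination t * hdw - d * ht

end QFrob

section Model

variable {q : ℕ} {F : Type} [Field F]

/-- The point set of a subspace. -/
def ptsOf (W : Submodule F (Fin 4 → F)) : Set (Pt F) := {P : Pt F | P.submodule ≤ W}

lemma mk_mem_ptsOf {W : Submodule F (Fin 4 → F)} {v : Fin 4 → F} {hv : v ≠ 0} :
    Projectivization.mk F v hv ∈ ptsOf W ↔ v ∈ W := by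
  simp [ptsOf, Projectivization.submodule_mk, Submodule.span_singleton_le_iff_mem]

lemma mem_span_pair_vec {v a b : Fin 4 → F} : v ∈ Submodule.span F {a, b} ↔
    ∃ s t : F, ∀ i, s * a i + t * b i = v i := by
  rw [Submodule.mem_span_pair]
  simp only [funext_iff, Pi.add_apply, Pi.smul_apply, smul_eq_mul]

lemma mk_mem_lineThrough {a b v : Fin 4 → F} {ha : a ≠ 0} {hb : b ≠ 0} {hv : v ≠ 0} :
    Projectivization.mk F v hv ∈ lineThrough F (Projectivization.mk F a ha)
      (Projectivization.mk F b hb) ↔ ∃ s t : F, ∀ i, s * a i + t * b i = v i := by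
  rw [← mem_span_pair_vec, Submodule.span_insert]
  simp [lineThrough, Projectivization.submodule_mk, Submodule.span_singleton_le_iff_mem]

/-- The vectors fixed by `tauFun q F 1`. -/
def baerVec (q : ℕ) (x y : F) : Fin 4 → F := ![x, y, x ^ q, y ^ q]

lemma baerVec_ne_zero {x y : F} (h : x ≠ 0 ∨ y ≠ 0) : baerVec q x y ≠ 0 := by
  intro h0
  rcases h with h | h
  · exact h (by simpa [baerVec] using congrFun h0 0)
  · exact h (by simpa [baerVec] using congrFun h0 1)

lemma mk_eq_of_smul {v w : Fin 4 → F} (hv : v ≠ 0) (hw : w ≠ 0) (a : F)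
    (h : ∀ i, a * w i = v i) : Projectivization.mk F v hv = Projectivization.mk F w hw := by
  rw [Projectivization.mk_eq_mk_iff']
  exact ⟨a, funext h⟩

lemma exists_smul_of_mk_eq {v w : Fin 4 → F} {hv : v ≠ 0} {hw : w ≠ 0}
    (h : Projectivization.mk F v hv = Projectivization.mk F w hw) :
    ∃ a : F, a ≠ 0 ∧ ∀ i, a * w i = v i := by
  rw [Projectivization.mk_eq_mk_iff'] at h
  obtain ⟨a, rfl⟩ := h
  exact ⟨a, fun h0 => hv (by simp [h0]), fun i => rfl⟩

lemma exists_rep_smul (v : Fin 4 → F) (hv : v ≠ 0) :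
    ∃ a : F, a ≠ 0 ∧ ∀ i, (Projectivization.mk F v hv).rep i = a * v i := by
  obtain ⟨a, ha⟩ := Projectivization.exists_smul_eq_mk_rep F v hv
  exact ⟨a, a.ne_zero, fun i => by rw [← ha]; rfl⟩

lemma mem_sigma_iff (hf : QFrob q F) {η : F} (hη : η ^ (q + 1) = 1) (P : Pt F) :
    P ∈ SigmaSet q F η ↔
      ∃ (x y : F) (h : x ≠ 0 ∨ y ≠ 0),
        P = Projectivization.mk F _ (baerVec_ne_zero (q := q) h) := by
  obtain ⟨d, hd, hdη⟩ := hf.exists_eq_mul_pow hη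
  have hη0 : η ≠ 0 := fun h => hd (by rw [hdη, h, zero_mul])
  constructor
  · rintro ⟨x, y, h, rfl⟩
    have hxy : d ^ q * x ≠ 0 ∨ d ^ q * y ≠ 0 := by
      by_contra! h0
      have hd' := pow_ne_zero q hd
      simp only [mul_eq_zero, hd', false_or] at h0
      apply h
      rw [h0.1, h0.2]
      funext i
      fin_cases i <;> simp [hf.ne_zero]
    refine ⟨d ^ q * x, d ^ q * y, hxy, ?_⟩
    symm
    refine mk_eq_of_smul _ _ (d ^ q) fun i => ?_
    fin_cases i <;> simp only [baerVec, mul_pow, hf.invol] <;> simp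
    · linear_combination (-x ^ q) * hdη
    · linear_combination (-y ^ q) * hdη
  · rintro ⟨x, y, h, rfl⟩
    have hd' := pow_ne_zero q hd
    have hv : ![x / d ^ q, y / d ^ q, η * (x / d ^ q) ^ q, η * (y / d ^ q) ^ q] ≠ 0 := by
      intro h0
      rcases h with h | h
      · have := congrFun h0 0
        simp [h, hd'] at this
      · have := congrFun h0 1
        simp [h, hd'] at this
    refine ⟨x / d ^ q, y / d ^ q, hv, ?_⟩
    refine mk_eq_of_smul _ _ (d ^ q) fun i => ?_
    fin_cases i <;> simp only [baerVec, div_pow, hf.invol] <;> simp <;> field_simp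
    · linear_combination (-x ^ q) * hdη
    · linear_combination (-y ^ q) * hdη

lemma sigmaSet_eq (hf : QFrob q F) {η : F} (hη : η ^ (q + 1) = 1) :
    SigmaSet q F η = SigmaSet q F 1 := by
  ext P
  rw [mem_sigma_iff hf hη, mem_sigma_iff hf (one_pow _)]

lemma tau_eq {η : F} (hη : η ^ (q + 1) = 1) : tau q F η = tau q F 1 := by
  funext P
  simp only [tau, tauFun, hη, one_pow]

lemma tauFun_one (v : Fin 4 → F) :
    tauFun q F 1 v = ![v 2 ^ q, v 3 ^ q, v 0 ^ q, v 1 ^ q] := by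
  simp [tauFun]

lemma vec4_eq_zero {v : Fin 4 → F} (h0 : v 0 = 0) (h1 : v 1 = 0) (h2 : v 2 = 0) (h3 : v 3 = 0) :
    v = 0 := by
  funext i
  fin_cases i <;> simpa

lemma tauFun_ne_zero {v : Fin 4 → F} (hv : v ≠ 0) : tauFun q F 1 v ≠ 0 := by
  intro h
  rw [tauFun_one] at h
  apply hv
  have h0 := congrFun h 0
  have h1 := congrFun h 1
  have h2 := congrFun h 2
  have h3 := congrFun h 3
  simp at h0 h1 h2 h3
  exact vec4_eq_zero h2.1 h3.1 h0.1 h1.1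

lemma tau_mk {v : Fin 4 → F} (hv : v ≠ 0) :
    tau q F 1 (Projectivization.mk F v hv) =
      Projectivization.mk F _ (tauFun_ne_zero (q := q) hv) := by
  obtain ⟨a, ha, h⟩ := exists_rep_smul v hv
  rw [tau, dif_pos (tauFun_ne_zero (Projectivization.rep_nonzero _))]
  refine mk_eq_of_smul _ _ (a ^ q) fun i => ?_
  fin_cases i <;> simp [tauFun_one, h, mul_pow]

lemma tau_tau (hf : QFrob q F) (P : Pt F) : tau q F 1 (tau q F 1 P) = P := by
  induction P using Projectivization.ind with
  | h v hv =>
    rw [tau_mk, tau_mk]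
    refine mk_eq_of_smul _ _ 1 fun i => ?_
    fin_cases i <;> simp [tauFun_one, hf.invol]

lemma mem_t1_mk {v : Fin 4 → F} {hv : v ≠ 0} :
    Projectivization.mk F v hv ∈ t1 F ↔ v 2 = 0 ∧ v 3 = 0 := by
  obtain ⟨a, ha, h⟩ := exists_rep_smul v hv
  simp [t1, h, ha]

lemma mem_rU1_mk {v : Fin 4 → F} {hv : v ≠ 0} :
    Projectivization.mk F v hv ∈ rU1 F ↔ v 1 = 0 ∧ v 3 = 0 := by
  obtain ⟨a, ha, h⟩ := exists_rep_smul v hv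
  simp [rU1, h, ha]

lemma mem_planeSet_mk {α v : F} {w : Fin 4 → F} {hw : w ≠ 0} :
    Projectivization.mk F w hw ∈ planeSet F α v ↔ w 3 = α * v * w 1 := by
  obtain ⟨a, ha, h⟩ := exists_rep_smul w hw
  simp only [planeSet, Set.mem_ofPred_eq, h]
  constructor
  · intro h1
    apply mul_left_cancel₀ ha
    linear_combination h1
  · intro h1
    linear_combination a * h1

lemma mk_mem_sigma (hf : QFrob q F) {x y : F} (h : x ≠ 0 ∨ y ≠ 0) :
    Projectivization.mk F _ (baerVec_ne_zero (q := q) h) ∈ SigmaSet q F 1 :=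
  (mem_sigma_iff hf (one_pow _) _).2 ⟨x, y, h, rfl⟩

/-- Subsets of the Baer subgeometry are compared on the vectors `baerVec q x y`. -/
lemma sigma_subset_ext (hf : QFrob q F) {A B : Set (Pt F)} (hA : A ⊆ SigmaSet q F 1)
    (hB : B ⊆ SigmaSet q F 1)
    (h : ∀ (x y : F) (h : x ≠ 0 ∨ y ≠ 0),
      Projectivization.mk F _ (baerVec_ne_zero (q := q) h) ∈ A ↔
        Projectivization.mk F _ (baerVec_ne_zero (q := q) h) ∈ B) : A = B := by
  ext P
  constructor
  · intro hP
    obtain ⟨x, y, hxy, rfl⟩ := (mem_sigma_iff hf (one_pow _) P).1 (hA hP)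
    exact (h x y hxy).1 hP
  · intro hP
    obtain ⟨x, y, hxy, rfl⟩ := (mem_sigma_iff hf (one_pow _) P).1 (hB hP)
    exact (h x y hxy).2 hP

end Model

section Lines

variable {q : ℕ} {F : Type} [Field F]

/-- The point with coordinate vector `baerVec q x y` exists and lies in `m`. -/
def BMem (q : ℕ) (m : Set (Pt F)) (x y : F) : Prop :=
  ∃ h : x ≠ 0 ∨ y ≠ 0, Projectivization.mk F _ (baerVec_ne_zero (q := q) h) ∈ m

lemma eq_of_bMem_iff (hf : QFrob q F) {A B : Set (Pt F)} (hA : A ⊆ SigmaSet q F 1)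
    (hB : B ⊆ SigmaSet q F 1)
    (h : ∀ x y : F, x ≠ 0 ∨ y ≠ 0 → (BMem q A x y ↔ BMem q B x y)) : A = B := by
  refine sigma_subset_ext hf hA hB fun x y hxy => ?_
  have := h x y hxy
  simpa only [BMem, hxy, exists_true_left] using this

lemma bMem_inter_sigma (hf : QFrob q F) {A : Set (Pt F)} {x y : F} (h : x ≠ 0 ∨ y ≠ 0) :
    BMem q (A ∩ SigmaSet q F 1) x y ↔
      Projectivization.mk F _ (baerVec_ne_zero (q := q) h) ∈ A :=
  ⟨fun ⟨_, h1⟩ => h1.1, fun h1 => ⟨h, h1, mk_mem_sigma hf h⟩⟩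

lemma forall_fin_four {p : Fin 4 → Prop} : (∀ i, p i) ↔ p 0 ∧ p 1 ∧ p 2 ∧ p 3 := by
  constructor
  · exact fun h => ⟨h 0, h 1, h 2, h 3⟩
  · rintro ⟨h0, h1, h2, h3⟩ i
    fin_cases i <;> assumption

lemma BMem.inter {m m' : Set (Pt F)} {x y : F} (h : BMem q m x y) (h' : BMem q m' x y) :
    (m ∩ m').Nonempty := by
  obtain ⟨h0, h1⟩ := h
  obtain ⟨_, h2⟩ := h'
  exact ⟨_, h1, h2⟩

/-- The line of the Baer subgeometry with `(x, y)` an `F`-multiple of `(a, b)`. -/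
def desLine (q : ℕ) (a b : F) : Set (Pt F) :=
  {P | ∃ (x y : F) (h : x ≠ 0 ∨ y ≠ 0),
    P = Projectivization.mk F _ (baerVec_ne_zero (q := q) h) ∧ x * b = y * a}

lemma mk_baerVec_eq {x y x' y' : F} {h : x ≠ 0 ∨ y ≠ 0} {h' : x' ≠ 0 ∨ y' ≠ 0}
    (he : Projectivization.mk F _ (baerVec_ne_zero (q := q) h) =
      Projectivization.mk F _ (baerVec_ne_zero (q := q) h')) :
    ∃ a : F, a ≠ 0 ∧ a ^ q = a ∧ x = a * x' ∧ y = a * y' := by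
  obtain ⟨a, ha, hi⟩ := exists_smul_of_mk_eq he
  have h0 := hi 0
  have h1 := hi 1
  have h2 := hi 2
  have h3 := hi 3
  simp [baerVec] at h0 h1 h2 h3
  refine ⟨a, ha, ?_, h0.symm, h1.symm⟩
  rw [← h0, mul_pow] at h2
  rw [← h1, mul_pow] at h3
  rcases h' with h' | h'
  · exact (mul_right_cancel₀ (pow_ne_zero q h') h2).symm
  · exact (mul_right_cancel₀ (pow_ne_zero q h') h3).symm

lemma desLine_subset (hf : QFrob q F) (a b : F) : desLine q a b ⊆ SigmaSet q F 1 := by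
  rintro P ⟨x, y, h, rfl, -⟩
  exact mk_mem_sigma hf h

lemma bMem_desLine {a b x y : F} (h : x ≠ 0 ∨ y ≠ 0) :
    BMem q (desLine q a b) x y ↔ x * b = y * a := by
  constructor
  · rintro ⟨h, x', y', h', he, hb⟩
    obtain ⟨s, hs, -, rfl, rfl⟩ := mk_baerVec_eq (h := h) (h' := h') he
    linear_combination s * hb
  · exact fun hb => ⟨h, x, y, h, rfl, hb⟩

/-- The line of the Baer subgeometry joining `P` to its image under `τ`. -/
def tauLine (q : ℕ) (P : Pt F) : Set (Pt F) :=
  lineThrough F P (tau q F 1 P) ∩ SigmaSet q F 1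

lemma tauLine_tau (hf : QFrob q F) (P : Pt F) : tauLine q (tau q F 1 P) = tauLine q P := by
  rw [tauLine, tauLine, tau_tau hf, lineThrough, lineThrough, sup_comm]

lemma bMem_tauLine (hf : QFrob q F) {v : Fin 4 → F} (hv : v ≠ 0) {x y : F} (h : x ≠ 0 ∨ y ≠ 0) :
    BMem q (tauLine q (Projectivization.mk F v hv)) x y ↔ ∃ s t : F,
      s * v 0 + t * v 2 ^ q = x ∧ s * v 1 + t * v 3 ^ q = y ∧
      s * v 2 + t * v 0 ^ q = x ^ q ∧ s * v 3 + t * v 1 ^ q = y ^ q := by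
  rw [tauLine, bMem_inter_sigma hf h, tau_mk, mk_mem_lineThrough]
  simp [forall_fin_four, tauFun_one, baerVec]

lemma tauLine_t1 (hf : QFrob q F) {a b : F} (hab : a ≠ 0 ∨ b ≠ 0) {v : Fin 4 → F} (hv : v ≠ 0)
    (h0 : v 0 = a) (h1 : v 1 = b) (h2 : v 2 = 0) (h3 : v 3 = 0) :
    tauLine q (Projectivization.mk F v hv) = desLine q a b := by
  refine eq_of_bMem_iff hf Set.inter_subset_right (desLine_subset hf _ _) fun x y h => ?_
  rw [bMem_tauLine hf hv h, bMem_desLine h, h0, h1, h2, h3]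
  simp only [hf.zero_pow, mul_zero, add_zero, zero_add]
  constructor
  · rintro ⟨s, t, rfl, rfl, -, -⟩
    ring
  · intro hxy
    rcases hab with ha | hb
    · refine ⟨x / a, (x / a) ^ q, by field_simp, by field_simp; linear_combination hxy, ?_, ?_⟩
      · rw [← mul_pow, div_mul_cancel₀ _ ha]
      · rw [← mul_pow]
        congr 1
        field_simp
        linear_combination hxy
    · refine ⟨y / b, (y / b) ^ q, by field_simp; linear_combination -hxy, by field_simp, ?_, ?_⟩
      · rw [← mul_pow]
        congr 1
        field_simp
        linear_combination -hxy
      · rw [← mul_pow, div_mul_cancel₀ _ hb]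

lemma mem_Dspread_iff (hf : QFrob q F) (m : Set (Pt F)) :
    m ∈ Dspread q F 1 ↔ ∃ a b : F, (a ≠ 0 ∨ b ≠ 0) ∧ m = desLine q a b := by
  constructor
  · rintro ⟨P, hP, rfl⟩
    induction P using Projectivization.ind with
    | h v hv =>
      rw [mem_t1_mk] at hP
      have hab : v 0 ≠ 0 ∨ v 1 ≠ 0 := by
        by_contra! h
        exact hv (vec4_eq_zero h.1 h.2 hP.1 hP.2)
      exact ⟨v 0, v 1, hab, tauLine_t1 hf hab hv rfl rfl hP.1 hP.2⟩
  · rintro ⟨a, b, hab, rfl⟩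
    have hv : ![a, b, 0, 0] ≠ 0 := by
      intro h
      rcases hab with h' | h'
      · exact h' (by simpa using congrFun h 0)
      · exact h' (by simpa using congrFun h 1)
    refine ⟨Projectivization.mk F _ hv, ?_, ?_⟩
    · rw [mem_t1_mk]
      simp
    · exact (tauLine_t1 hf hab hv rfl rfl rfl rfl).symm

lemma desLine_mem_Dspread (hf : QFrob q F) {a b : F} (h : a ≠ 0 ∨ b ≠ 0) :
    desLine q a b ∈ Dspread q F 1 :=
  (mem_Dspread_iff hf _).2 ⟨a, b, h, rfl⟩

lemma desLine_smul (hf : QFrob q F) {a b a' b' s : F} (hs : s ≠ 0) (ha : a = s * a')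
    (hb : b = s * b') : desLine q a b = desLine q a' b' := by
  refine eq_of_bMem_iff hf (desLine_subset hf _ _) (desLine_subset hf _ _) fun x y h => ?_
  rw [bMem_desLine h, bMem_desLine h, ha, hb]
  constructor
  · intro h1
    apply mul_left_cancel₀ hs
    linear_combination h1
  · intro h1
    linear_combination s * h1

lemma mem_Dspread_cases (hf : QFrob q F) {m : Set (Pt F)} (hm : m ∈ Dspread q F 1) :
    m = desLine q 1 0 ∨ ∃ z, m = desLine q z 1 := by
  obtain ⟨a, b, hab, rfl⟩ := (mem_Dspread_iff hf _).1 hm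
  by_cases hb : b = 0
  · subst hb
    exact Or.inl (desLine_smul hf (hab.resolve_right (by simp)) (mul_one _).symm (by simp))
  · exact Or.inr ⟨a / b, desLine_smul hf hb (by field_simp) (mul_one _).symm⟩

lemma rU1_inter (hf : QFrob q F) : rU1 F ∩ SigmaSet q F 1 = desLine q 1 0 := by
  refine eq_of_bMem_iff hf Set.inter_subset_right (desLine_subset hf _ _) fun x y h => ?_
  rw [bMem_desLine h, bMem_inter_sigma hf h, mem_rU1_mk]
  simp [baerVec, hf.ne_zero, eq_comm]

/-- Lines joining an affine point to its image are graphs of additive polynomials. -/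
lemma bMem_tauLine_affine (hf : QFrob q F) {p r μ : F} (hμ : 1 - μ ^ q * μ ≠ 0)
    {v : Fin 4 → F} (hv : v ≠ 0) (h0 : v 0 = p) (h1 : v 1 = 1) (h2 : v 2 = r) (h3 : v 3 = μ)
    {x y : F} (h : x ≠ 0 ∨ y ≠ 0) :
    BMem q (tauLine q (Projectivization.mk F v hv)) x y ↔
      (1 - μ ^ q * μ) * x = (p - r ^ q * μ) * y + (r ^ q - p * μ ^ q) * y ^ q := by
  rw [bMem_tauLine hf hv h, h0, h1, h2, h3, one_pow]
  constructor
  · rintro ⟨s, t, hx, hy, -, hyq⟩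
    rw [← hyq, ← hy, ← hx]
    ring
  · intro hx
    have hx' : x = ((p - r ^ q * μ) * y + (r ^ q - p * μ ^ q) * y ^ q) / (1 - μ ^ q * μ) := by
      rw [eq_div_iff hμ, mul_comm]
      exact hx
    refine ⟨(y - μ ^ q * y ^ q) / (1 - μ ^ q * μ), (y ^ q - μ * y) / (1 - μ ^ q * μ),
      ?_, ?_, ?_, ?_⟩
    · rw [hx']
      field_simp
      ring
    · field_simp
      ring
    · have hN : (1 - μ ^ q * μ) ^ q = 1 - μ ^ q * μ := by
        rw [hf.sub, mul_pow, hf.invol, one_pow, mul_comm]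
      rw [hx', div_pow, hN, hf.add, mul_pow, mul_pow, hf.sub, hf.sub, mul_pow, mul_pow, hf.invol,
        hf.invol, hf.invol]
      field_simp
      ring
    · field_simp
      ring

lemma tauLine_eq_desLine_affine (hf : QFrob q F) {z μ : F} (hμ : 1 - μ ^ q * μ ≠ 0)
    {v : Fin 4 → F} (hv : v ≠ 0) (h0 : v 0 = z) (h1 : v 1 = 1) (h2 : v 2 = μ * z ^ q)
    (h3 : v 3 = μ) : tauLine q (Projectivization.mk F v hv) = desLine q z 1 := by
  refine eq_of_bMem_iff hf Set.inter_subset_right (desLine_subset hf _ _) fun x y h => ?_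
  rw [bMem_tauLine_affine hf hμ hv h0 h1 h2 h3 h, bMem_desLine h, mul_pow, hf.invol]
  constructor
  · intro h
    apply mul_left_cancel₀ hμ
    linear_combination h
  · intro h
    linear_combination (1 - μ ^ q * μ) * h

/-- A point joined to its image by a line of the Desarguesian spread. -/
lemma of_tauLine_eq_desLine (hf : QFrob q F) {v : Fin 4 → F} (hv : v ≠ 0) {a b : F}
    (h : tauLine q (Projectivization.mk F v hv) = desLine q a b) :
    v 0 * b = v 1 * a ∧ v 2 * b ^ q = v 3 * a ^ q := by
  have key : ∀ s : F, (v 0 * b - v 1 * a) * s + (v 2 ^ q * b - v 3 ^ q * a) * s ^ q = 0 := by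
    intro s
    by_cases hxy : s * v 0 + s ^ q * v 2 ^ q ≠ 0 ∨ s * v 1 + s ^ q * v 3 ^ q ≠ 0
    · have h1 := (bMem_tauLine hf hv hxy).2 ⟨s, s ^ q, rfl, rfl, by
        rw [hf.add, mul_pow, mul_pow, hf.invol, hf.invol]; ring, by
        rw [hf.add, mul_pow, mul_pow, hf.invol, hf.invol]; ring⟩
      rw [h, bMem_desLine hxy] at h1
      linear_combination h1
    · push Not at hxy
      linear_combination b * hxy.1 - a * hxy.2
  obtain ⟨h1, h2⟩ := hf.coeff_eq_zero key
  refine ⟨by linear_combination h1, hf.inj ?_⟩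
  rw [mul_pow, mul_pow, hf.invol, hf.invol]
  linear_combination h2

lemma tauLine_eq_desLine_inf (hf : QFrob q F) {c : F} (hc : 1 - c ^ q * c ≠ 0)
    {v : Fin 4 → F} (hv : v ≠ 0) (h0 : v 0 = 1) (h1 : v 1 = 0) (h2 : v 2 = c)
    (h3 : v 3 = 0) : tauLine q (Projectivization.mk F v hv) = desLine q 1 0 := by
  refine eq_of_bMem_iff hf Set.inter_subset_right (desLine_subset hf _ _) fun x y h => ?_
  rw [bMem_tauLine hf hv h, bMem_desLine h, h0, h1, h2, h3]
  simp only [hf.zero_pow, mul_zero, add_zero, one_pow, mul_one]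
  constructor
  · rintro ⟨s, t, -, h, -, -⟩
    exact h
  · rintro rfl
    refine ⟨(x - c ^ q * x ^ q) / (1 - c ^ q * c), (x ^ q - c * x) / (1 - c ^ q * c),
      ?_, rfl, ?_, by rw [hf.zero_pow]⟩
    · field_simp
      ring
    · field_simp
      ring

lemma exists_bMem_of_meets {m : Set (Pt F)} {z : F} (h : (m ∩ desLine q z 1).Nonempty) :
    ∃ a : F, a ≠ 0 ∧ BMem q m (z * a) a := by
  obtain ⟨P, hP, x, y, hxy, rfl, hb⟩ := h
  have hx : x = z * y := by linear_combination hb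
  subst hx
  exact ⟨y, fun h0 => by simp [h0] at hxy, hxy, hP⟩

lemma ncard_insert_image {α β : Type} (p : α) (f : β → α) (K : Set β) (hK : K.ncard = q)
    (hq : q ≠ 0) (hf : Function.Injective f) (hp : ∀ k ∈ K, f k ≠ p) :
    (insert p (f '' K)).ncard = q + 1 := by
  have hfin : K.Finite := Set.finite_of_ncard_ne_zero (by omega)
  rw [Set.ncard_insert_of_notMem (by rintro ⟨k, hk, h⟩; exact hp k hk h) (hfin.image f),
    Set.ncard_image_of_injective _ hf, hK]

/-- The line of the Baer subgeometry spanned by `(1, 0)` and `(d⁻¹ z, d⁻¹)`. -/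
def secLine (q : ℕ) (d z : F) : Set (Pt F) :=
  ptsOf (Submodule.span F {baerVec q 1 0, baerVec q (d⁻¹ * z) d⁻¹}) ∩ SigmaSet q F 1

lemma bMem_secLine (hf : QFrob q F) {d z x y : F} (hd : d ≠ 0) (h : x ≠ 0 ∨ y ≠ 0) :
    BMem q (secLine q d z) x y ↔
      ∃ s t : F, s ^ q = s ∧ t ^ q = t ∧ x = s + t * (d⁻¹ * z) ∧ y = t * d⁻¹ := by
  have hd' : d⁻¹ ≠ 0 := inv_ne_zero hd
  rw [secLine, bMem_inter_sigma hf h, mk_mem_ptsOf, mem_span_pair_vec]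
  simp only [forall_fin_four, baerVec, Matrix.cons_val, one_pow, hf.zero_pow, mul_one, mul_zero,
    zero_add]
  constructor
  · rintro ⟨s, t, h0, h1, h2, h3⟩
    have ht : t ^ q = t := by
      apply mul_right_cancel₀ (pow_ne_zero q hd')
      rw [← mul_pow, h1, h3]
    refine ⟨s, t, ?_, ht, h0.symm, h1.symm⟩
    rw [← h0, hf.add, mul_pow t, ht] at h2
    linear_combination -h2
  · rintro ⟨s, t, hs, ht, rfl, rfl⟩
    refine ⟨s, t, ?_⟩
    simp only [hf.add, mul_pow, hs, ht, and_self]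

end Lines

section Secants

variable {q : ℕ} {F : Type} [Field F]

lemma finrank_span_pair_of_indep {u v : Fin 4 → F}
    (h : ∀ s t : F, s • u + t • v = 0 → s = 0 ∧ t = 0) :
    Module.finrank F (Submodule.span F {u, v}) = 2 := by
  have hli : LinearIndependent F ![u, v] := LinearIndependent.pair_iff.2 h
  have := finrank_span_eq_card hli
  rwa [Matrix.range_cons_cons_empty, Fintype.card_fin] at this

lemma eq_span_pair {W : Submodule F (Fin 4 → F)} (hW : Module.finrank F W = 2)
    {u v : Fin 4 → F} (hu : u ∈ W) (hv : v ∈ W)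
    (h : ∀ s t : F, s • u + t • v = 0 → s = 0 ∧ t = 0) : W = Submodule.span F {u, v} := by
  symm
  refine Submodule.eq_of_le_of_finrank_eq ?_ ?_
  · rw [Submodule.span_le]
    rintro x (rfl | rfl)
    · exact hu
    · exact hv
  · rw [hW, finrank_span_pair_of_indep h]

lemma isLine_span_pair {u v : Fin 4 → F}
    (h : ∀ s t : F, s • u + t • v = 0 → s = 0 ∧ t = 0) :
    isLine F (ptsOf (Submodule.span F {u, v})) :=
  ⟨_, finrank_span_pair_of_indep h, rfl⟩

lemma fixed_of_comb (hf : QFrob q F) {x y x₁ a b s t : F} (hx₁ : x₁ ≠ 0) (ha : a ≠ 0)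
    (h0 : s * x₁ + t * b = x) (h1 : t * a = y) (h2 : s * x₁ ^ q + t * b ^ q = x ^ q)
    (h3 : t * a ^ q = y ^ q) : s ^ q = s ∧ t ^ q = t := by
  have ht : t ^ q = t := by
    apply mul_right_cancel₀ (pow_ne_zero q ha)
    rw [← mul_pow, h1, h3]
  refine ⟨?_, ht⟩
  apply mul_right_cancel₀ (pow_ne_zero q hx₁)
  rw [← h0, hf.add, mul_pow, mul_pow, ht] at h2
  linear_combination -h2

lemma baerVec_pair_indep {x a b : F} (hx : x ≠ 0) (ha : a ≠ 0) (s t : F)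
    (h : s • baerVec q x 0 + t • baerVec q b a = 0) : s = 0 ∧ t = 0 := by
  have h0 := congrFun h 0
  have h1 := congrFun h 1
  simp [baerVec, ha] at h0 h1
  subst h1
  simpa [hx] using h0

lemma IsLineOfSigma.param (hf : QFrob q F) {m : Set (Pt F)} (hm : IsLineOfSigma q F 1 m)
    {x a b x' y' : F} (ha : a ≠ 0) (h1 : BMem q m x 0) (h2 : BMem q m b a) (h3 : BMem q m x' y') :
    ∃ s t : F, s ^ q = s ∧ t ^ q = t ∧ x' = s * x + t * b ∧ y' = t * a := by
  obtain ⟨_, ⟨W, hW, rfl⟩, rfl, -⟩ := hm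
  obtain ⟨hx, h1, -⟩ := h1
  obtain ⟨_, h2, -⟩ := h2
  obtain ⟨_, h3, -⟩ := h3
  have hx : x ≠ 0 := hx.resolve_right (by simp)
  change _ ∈ ptsOf W at h1 h2 h3
  rw [mk_mem_ptsOf] at h1 h2 h3
  rw [eq_span_pair hW h1 h2 (baerVec_pair_indep hx ha), mem_span_pair_vec] at h3
  obtain ⟨s, t, h⟩ := h3
  simp only [forall_fin_four, baerVec, Matrix.cons_val, hf.zero_pow, mul_zero, zero_add] at h
  obtain ⟨hs, ht⟩ := fixed_of_comb hf hx ha h.1 h.2.1 h.2.2.1 h.2.2.2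
  exact ⟨s, t, hs, ht, h.1.symm, h.2.1.symm⟩

/-- A line meeting the line at infinity meets the affine lines of the Desarguesian spread in a
Baer subline. -/
lemma IsLineOfSigma.ratio_fixed (hf : QFrob q F) {m : Set (Pt F)} (hm : IsLineOfSigma q F 1 m)
    {x z₁ z₂ z₃ a₁ a₂ a₃ : F} (ha₁ : a₁ ≠ 0) (ha₂ : a₂ ≠ 0) (ha₃ : a₃ ≠ 0)
    (h : BMem q m x 0) (h₁ : BMem q m (z₁ * a₁) a₁) (h₂ : BMem q m (z₂ * a₂) a₂)
    (h₃ : BMem q m (z₃ * a₃) a₃) (hne : z₂ ≠ z₁) :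
    ((z₃ - z₁) / (z₂ - z₁)) ^ q = (z₃ - z₁) / (z₂ - z₁) := by
  have hx : x ≠ 0 := h.1.resolve_right (by simp)
  obtain ⟨s, t, hs, ht, e1, e2⟩ := hm.param hf ha₁ h h₁ h₂
  obtain ⟨s', t', hs', ht', e1', e2'⟩ := hm.param hf ha₁ h h₁ h₃
  have ht0 : t ≠ 0 := fun h0 => ha₂ (by rw [e2, h0, zero_mul])
  have ht0' : t' ≠ 0 := fun h0 => ha₃ (by rw [e2', h0, zero_mul])
  have hz : z₂ - z₁ = s * x / (t * a₁) := by
    rw [e2] at e1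
    rw [eq_div_iff (mul_ne_zero ht0 ha₁)]
    linear_combination e1
  have hz' : z₃ - z₁ = s' * x / (t' * a₁) := by
    rw [e2'] at e1'
    rw [eq_div_iff (mul_ne_zero ht0' ha₁)]
    linear_combination e1'
  have hs0 : s ≠ 0 := fun h0 => by
    rw [h0, zero_mul, zero_div, sub_eq_zero] at hz
    exact hne hz
  have : (z₃ - z₁) / (z₂ - z₁) = s' * t / (t' * s) := by
    rw [hz, hz']
    field_simp
  rw [this, div_pow, mul_pow, mul_pow, hs, ht, hs', ht']

lemma secLine_isLine (hf : QFrob q F) {d : F} (hd : d ≠ 0) (z : F) :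
    IsLineOfSigma q F 1 (secLine q d z) := by
  have hd' : d⁻¹ ≠ 0 := inv_ne_zero hd
  refine ⟨_, isLine_span_pair (baerVec_pair_indep one_ne_zero hd'), rfl, ?_⟩
  have hne (s : F) : s + d⁻¹ * z ≠ 0 ∨ d⁻¹ ≠ 0 := Or.inr hd'
  have h10 : (1 : F) ≠ 0 ∨ (0 : F) ≠ 0 := Or.inl one_ne_zero
  have hset : secLine q d z =
      insert (Projectivization.mk F _ (baerVec_ne_zero (q := q) h10))
        ((fun s => Projectivization.mk F _ (baerVec_ne_zero (q := q) (hne s))) ''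
          {s : F | s ^ q = s}) := by
    ext P
    constructor
    · intro hP
      obtain ⟨x, y, hxy, rfl⟩ := (mem_sigma_iff hf (one_pow _) P).1 hP.2
      obtain ⟨s, t, hs, ht, rfl, rfl⟩ := (bMem_secLine hf hd hxy).1 ⟨hxy, hP⟩
      by_cases ht0 : t = 0
      · left
        refine mk_eq_of_smul _ _ s fun i => ?_
        fin_cases i <;> simp [ht0, baerVec, hf.ne_zero, hs]
      · right
        refine ⟨s / t, ?_, ?_⟩
        · simp only [Set.mem_ofPred_eq, div_pow, hs, ht]
        · symm
          refine mk_eq_of_smul _ _ t fun i => ?_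
          fin_cases i <;> simp [baerVec, hf.add, mul_pow, div_pow, hs, ht] <;> field_simp
    · rintro (rfl | ⟨s, hs, rfl⟩)
      · exact ((bMem_secLine hf hd h10).2 ⟨1, 0, one_pow _, hf.zero_pow, by simp, by simp⟩).2
      · exact ((bMem_secLine hf hd (hne s)).2 ⟨s, 1, hs, one_pow _, by simp, by simp⟩).2
  rw [hset]
  refine ncard_insert_image _ _ _ hf.ncard_fixed hf.ne_zero ?_ ?_
  · intro s s' h
    obtain ⟨a, -, -, h1, h2⟩ := mk_baerVec_eq (h := hne s) (h' := hne s') h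
    have ha : a = 1 := by
      apply mul_right_cancel₀ hd'
      rw [← h2, one_mul]
    subst ha
    linear_combination h1
  · intro s _ h
    obtain ⟨a, -, -, -, h2⟩ := mk_baerVec_eq (h := hne s) (h' := h10) h
    simp [hd] at h2

lemma secLine_bMem_inf (hf : QFrob q F) {d : F} (hd : d ≠ 0) (z : F) :
    BMem q (secLine q d z) 1 0 :=
  (bMem_secLine hf hd (Or.inl one_ne_zero)).2 ⟨1, 0, one_pow _, hf.zero_pow, by simp, by simp⟩

lemma secLine_bMem (hf : QFrob q F) {d k : F} (hd : d ≠ 0) (z : F) (hk : (k / d) ^ q = k / d) :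
    BMem q (secLine q d z) ((z + k) * d⁻¹) d⁻¹ :=
  (bMem_secLine hf hd (Or.inr (inv_ne_zero hd))).2 ⟨k / d, 1, hk, one_pow _, by
    field_simp
    ring, by simp⟩

lemma secLine_notMem_Dspread (hf : QFrob q F) {d : F} (hd : d ≠ 0) (z : F) :
    secLine q d z ∉ Dspread q F 1 := by
  intro h
  obtain ⟨a, b, hab, h⟩ := (mem_Dspread_iff hf _).1 h
  have h1 := secLine_bMem_inf hf hd z
  have h2 := secLine_bMem (k := d) hf hd z (by rw [div_self hd, one_pow])
  have h3 := secLine_bMem (k := 0) hf hd z (by rw [zero_div, hf.zero_pow])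
  rw [h, bMem_desLine h1.1] at h1
  rw [h, bMem_desLine h2.1] at h2
  rw [h, bMem_desLine h3.1] at h3
  have hb : b = 0 := by simpa using h1
  subst hb
  simp [hd] at h2
  simp [h2] at hab

end Secants

section HallLines

variable {q : ℕ} {F : Type} [Field F]

/-- The line through `(1, 0, c, 0)` and `(z, 1, cw z ^ q, cw)`. -/
def hallLine (q : ℕ) (c w z : F) : Set (Pt F) :=
  ptsOf (Submodule.span F {![1, 0, c, 0], ![z, 1, c * w * z ^ q, c * w]})

/-- The Hall spread obtained from the line `ℓ` by switching a regulus. -/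
def hallSpread (q : ℕ) (ℓ : Set (Pt F)) : Set (Set (Pt F)) :=
  (Sspread q F 1 ℓ \ Rreg q F 1 ℓ) ∪ Ropp q F 1 ℓ

/-- Admissible parameters of `hallLine`. -/
structure HallParam (q : ℕ) (c w : F) : Prop where
  ne_zero : c ≠ 0
  norm_ne_one : 1 - c ^ q * c ≠ 0
  norm_dir : w ^ (q + 1) = 1

lemma HallParam.norm_mul {c w : F} (h : HallParam q c w) : 1 - (c * w) ^ q * (c * w) ≠ 0 := by
  have h1 : 1 - (c * w) ^ q * (c * w) = 1 - c ^ q * c := by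
    linear_combination (-c ^ q * c) * h.norm_dir
  rw [h1]
  exact h.norm_ne_one

lemma vec_ne_zero_snd (a b c : F) : ![a, 1, b, c] ≠ 0 := fun h => by
  simpa using congrFun h 1

lemma hallLine_indep (c μ z r : F) (s t : F)
    (h : s • ![1, 0, c, 0] + t • ![z, 1, r, μ] = 0) : s = 0 ∧ t = 0 := by
  have h0 := congrFun h 0
  have h1 := congrFun h 1
  simp at h0 h1
  subst h1
  simpa using h0

lemma mk_mem_hallLine {c w z : F} {v : Fin 4 → F} {hv : v ≠ 0} :
    Projectivization.mk F v hv ∈ hallLine q c w z ↔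
      v 3 = c * w * v 1 ∧ v 2 = c * v 0 + (c * w * z ^ q - c * z) * v 1 := by
  rw [hallLine, mk_mem_ptsOf, mem_span_pair_vec]
  simp only [forall_fin_four, Matrix.cons_val, mul_one, mul_zero, zero_add]
  constructor
  · rintro ⟨s, t, h0, h1, h2, h3⟩
    rw [← h0, ← h1, ← h2, ← h3]
    constructor <;> ring
  · rintro ⟨h3, h2⟩
    refine ⟨v 0 - z * v 1, v 1, by ring, rfl, ?_, ?_⟩
    · rw [h2]
      ring
    · rw [h3]
      ring

lemma mem_hallLine_cases {c w z : F} {P : Pt F} (h : P ∈ hallLine q c w z) :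
    P = Projectivization.mk F ![1, 0, c, 0] (vec4_ne_zero_fst F _ _ _ _ one_ne_zero) ∨
      ∃ t, P = Projectivization.mk F ![z + t, 1, c * w * z ^ q + t * c, c * w]
        (vec_ne_zero_snd _ _ _) := by
  induction P using Projectivization.ind with
  | h v hv =>
    rw [mk_mem_hallLine] at h
    by_cases h1 : v 1 = 0
    · left
      refine mk_eq_of_smul _ _ (v 0) fun i => ?_
      fin_cases i <;> simp [h, h1]
      ring
    · right
      refine ⟨v 0 / v 1 - z, ?_⟩
      refine mk_eq_of_smul _ _ (v 1) fun i => ?_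
      fin_cases i <;> simp [h] <;> field_simp
      ring

lemma inf_mem_hallLine (c w z : F) :
    Projectivization.mk F ![1, 0, c, 0] (vec4_ne_zero_fst F _ _ _ _ one_ne_zero) ∈
      hallLine q c w z := by
  simp [mk_mem_hallLine]

lemma affine_mem_hallLine (c w z t : F) :
    Projectivization.mk F ![z + t, 1, c * w * z ^ q + t * c, c * w] (vec_ne_zero_snd _ _ _) ∈
      hallLine q c w z := by
  simp [mk_mem_hallLine]
  ring

lemma mem_Rreg_hallLine (hf : QFrob q F) {c w z : F} (h : HallParam q c w) {m : Set (Pt F)}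
    (hm : m ∈ Rreg q F 1 (hallLine q c w z)) :
    m = desLine q 1 0 ∨ ∃ k, k = w * k ^ q ∧ m = desLine q (z + k) 1 := by
  obtain ⟨hD, Q, hQ, hmQ⟩ := hm
  rcases mem_Dspread_cases hf hD with rfl | ⟨z', rfl⟩
  · exact Or.inl rfl
  · right
    rcases mem_hallLine_cases hQ with rfl | ⟨t, rfl⟩
    · have := (of_tauLine_eq_desLine hf _ hmQ.symm).1
      simp at this
    · have h1 := (of_tauLine_eq_desLine hf _ hmQ.symm)
      simp at h1
      obtain ⟨rfl, h2⟩ := h1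
      refine ⟨t, ?_, rfl⟩
      rw [hf.add] at h2
      apply mul_left_cancel₀ h.ne_zero
      linear_combination h2

lemma affine_mem_Rreg (hf : QFrob q F) {c w k : F} (h : HallParam q c w) (z : F)
    (hk : k = w * k ^ q) : desLine q (z + k) 1 ∈ Rreg q F 1 (hallLine q c w z) := by
  refine ⟨desLine_mem_Dspread hf (by simp), _, affine_mem_hallLine c w z k, ?_⟩
  refine (tauLine_eq_desLine_affine hf h.norm_mul
    (vec_ne_zero_snd (z + k) (c * w * z ^ q + k * c) (c * w)) rfl rfl ?_ rfl).symm
  simp [hf.add]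
  linear_combination c * hk

lemma secLine_mem_Ropp (hf : QFrob q F) {c w d : F} (h : HallParam q c w) (z : F) (hd : d ≠ 0)
    (hdw : d = w * d ^ q) : secLine q d z ∈ Ropp q F 1 (hallLine q c w z) := by
  refine ⟨secLine_isLine hf hd z, fun m hm => ?_⟩
  rcases mem_Rreg_hallLine hf h hm with rfl | ⟨k, hk, rfl⟩
  · exact (secLine_bMem_inf hf hd z).inter ((bMem_desLine (by simp)).2 (by simp))
  · exact (secLine_bMem hf hd z (QFrob.div_fixed hd hdw hk)).inter
      ((bMem_desLine (by simp [hd])).2 (by ring))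

lemma mem_Ropp_of_meets_inf (hf : QFrob q F) {c w z x : F} (h : HallParam q c w)
    {m : Set (Pt F)} (hm : m ∈ hallSpread q (hallLine q c w z)) (hmD : m ∉ Dspread q F 1)
    (hx : BMem q m x 0) : m ∈ Ropp q F 1 (hallLine q c w z) := by
  rcases hm with ⟨⟨Q, hQ, rfl⟩, -⟩ | hm
  · exfalso
    change BMem q (tauLine q Q) x 0 at hx
    rcases mem_hallLine_cases hQ with rfl | ⟨t, rfl⟩
    · apply hmD
      change tauLine q _ ∈ _
      rw [tauLine_eq_desLine_inf hf h.norm_ne_one _ rfl rfl rfl rfl]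
      exact desLine_mem_Dspread hf (by simp)
    · have hx0 : x ≠ 0 := hx.1.resolve_right (by simp)
      rw [bMem_tauLine_affine hf h.norm_mul _ rfl rfl rfl rfl hx.1] at hx
      simp only [mul_zero, hf.zero_pow, add_zero, mul_eq_zero] at hx
      exact hx.elim h.norm_mul hx0
  · exact hm

/-- The Hall spread determines the direction of its switched regulus. -/
lemma dir_eq_of_secLine_mem (hf : QFrob q F) {c w' z z' w d : F} (h : HallParam q c w')
    (hd : d ≠ 0) (hdw : d = w * d ^ q)
    (hm : secLine q d z' ∈ hallSpread q (hallLine q c w' z)) : w = w' := by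
  have hinf := secLine_bMem_inf hf hd z'
  have hR := mem_Ropp_of_meets_inf hf h hm (secLine_notMem_Dspread hf hd z') hinf
  obtain ⟨k, hk, hkw⟩ := hf.exists_eq_mul_pow h.norm_dir
  obtain ⟨a₁, ha₁, h₁⟩ := exists_bMem_of_meets (hR.2 _ (affine_mem_Rreg hf h z hkw))
  obtain ⟨a₀, ha₀, h₀⟩ := exists_bMem_of_meets (hR.2 _ (affine_mem_Rreg (k := 0) hf h z
    (by simp [hf.ne_zero])))
  have e1 := secLine_bMem (k := d) hf hd z' (by rw [div_self hd, one_pow])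
  have e0 := secLine_bMem (k := 0) hf hd z' (by rw [zero_div, hf.zero_pow])
  have hdi := inv_ne_zero hd
  have r1 := hR.1.ratio_fixed hf hdi hdi ha₁ hinf e0 e1 h₁ (by simpa using hd)
  have r0 := hR.1.ratio_fixed hf hdi hdi ha₀ hinf e0 e1 h₀ (by simpa using hd)
  have r : (k / d) ^ q = k / d := by
    have : k / d = (z + k - (z' + 0)) / (z' + d - (z' + 0)) -
        (z + 0 - (z' + 0)) / (z' + d - (z' + 0)) := by
      simp only [add_zero, add_sub_cancel_left]
      ring
    rw [this, hf.sub, r0, r1]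
  rw [div_pow, div_eq_div_iff (pow_ne_zero _ hd) hd] at r
  apply mul_right_cancel₀ (mul_ne_zero (pow_ne_zero q hd) (pow_ne_zero q hk))
  linear_combination r - k ^ q * hdw + d ^ q * hkw

end HallLines

section Normalisation

variable {q : ℕ} {F : Type} [Field F]

lemma hallSpread_congr {ℓ ℓ' : Set (Pt F)} (h : Sspread q F 1 ℓ = Sspread q F 1 ℓ') :
    hallSpread q ℓ = hallSpread q ℓ' := by
  simp only [hallSpread, Ropp, Rreg, h]

lemma tau_mem_hallLine (hf : QFrob q F) {c w z : F} (hc : c ≠ 0) (hw : w ^ (q + 1) = 1)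
    {P : Pt F} (h : P ∈ hallLine q c w z) :
    tau q F 1 P ∈ hallLine q (c ^ q)⁻¹ w z := by
  have hcq : c ^ q ≠ 0 := pow_ne_zero q hc
  have hw1 : w ^ q * w = 1 := by rw [← pow_succ, hw]
  rcases mem_hallLine_cases h with rfl | ⟨t, rfl⟩
  · rw [tau_mk, mk_mem_hallLine]
    simp [tauFun_one, hf.ne_zero, hcq]
  · rw [tau_mk, mk_mem_hallLine]
    simp only [tauFun_one, Matrix.cons_val, hf.add, mul_pow, hf.invol, one_pow]
    constructor
    · field_simp
      linear_combination -hw1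
    · field_simp
      linear_combination (-z ^ q) * hw1

lemma sspread_subset (hf : QFrob q F) {c w : F} (hc : c ≠ 0) (hw : w ^ (q + 1) = 1) (z : F) :
    Sspread q F 1 (hallLine q c w z) ⊆ Sspread q F 1 (hallLine q (c ^ q)⁻¹ w z) := by
  rintro m ⟨Q, hQ, rfl⟩
  exact ⟨_, tau_mem_hallLine hf hc hw hQ, (tauLine_tau hf Q).symm⟩

lemma hallSpread_inv (hf : QFrob q F) {c w : F} (hc : c ≠ 0) (hw : w ^ (q + 1) = 1) (z : F) :
    hallSpread q (hallLine q (c ^ q)⁻¹ w z) = hallSpread q (hallLine q c w z) := by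
  refine hallSpread_congr (Set.Subset.antisymm ?_ (sspread_subset hf hc hw z))
  have h := sspread_subset hf (inv_ne_zero (pow_ne_zero q hc)) hw z
  rwa [inv_pow, hf.invol, inv_inv] at h

end Normalisation

section Pencil

variable {q : ℕ} {F : Type} [Field F]

lemma hallLine_inter_sigma (hf : QFrob q F) {α u v : F} (hα : α ≠ 0) (hu : u ^ (q + 1) = 1)
    (hv : v ^ (q + 1) = 1) (z : F) :
    (hallLine q (α * u) (v / u) z ∩ SigmaSet q F α).ncard = q + 1 := by
  have hu0 : u ≠ 0 := fun h => by simp [h] at hu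
  have hv0 : v ≠ 0 := fun h => by simp [h] at hv
  have hw : (v / u) ^ (q + 1) = 1 := by rw [div_pow, hu, hv, div_one]
  have hμ : α * u * (v / u) = α * v := by field_simp
  have root {e : F} (he : e ^ (q + 1) = 1) (he0 : e ≠ 0) : ∃ y : F, y ≠ 0 ∧ y ^ q = e * y := by
    obtain ⟨y, hy, hye⟩ := hf.exists_eq_mul_pow (w := e⁻¹) (by rw [inv_pow, he, inv_one])
    refine ⟨y, hy, ?_⟩
    rw [eq_inv_mul_iff_mul_eq₀ he0] at hye
    exact hye.symm
  have hset : hallLine q (α * u) (v / u) z ∩ SigmaSet q F α =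
      insert (Ppt F α u) ((fun t => Projectivization.mk F
        ![z + t, 1, α * u * (v / u) * z ^ q + t * (α * u), α * u * (v / u)]
        (vec_ne_zero_snd _ _ _)) '' {t : F | t = v / u * t ^ q}) := by
    ext P
    constructor
    · rintro ⟨hP, x, y, h, he⟩
      rcases mem_hallLine_cases hP with rfl | ⟨t, rfl⟩
      · exact Or.inl rfl
      · refine Or.inr ⟨t, ?_, rfl⟩
        obtain ⟨a, ha, hi⟩ := exists_smul_of_mk_eq he
        rw [forall_fin_four] at hi
        obtain ⟨h0, h1, h2, h3⟩ := hi
        simp only [Matrix.cons_val] at h0 h1 h2 h3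
        have hx : x = (z + t) * y := by
          rw [← h0]
          linear_combination (-x) * h1
        rw [hx, mul_pow, hf.add] at h2
        simp only [Set.mem_ofPred_eq]
        apply mul_left_cancel₀ (mul_ne_zero hα hu0)
        linear_combination -h2 + (z ^ q + t ^ q) * h3
    · rintro (rfl | ⟨t, ht, rfl⟩)
      · refine ⟨inf_mem_hallLine _ _ _, ?_⟩
        obtain ⟨y, hy, hyu⟩ := root hu hu0
        refine ⟨y, 0, vec4_ne_zero_fst F _ _ _ _ hy, ?_⟩
        refine mk_eq_of_smul _ _ y⁻¹ fun i => ?_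
        fin_cases i <;> simp [hyu, hf.ne_zero, hy]
        field_simp
      · refine ⟨affine_mem_hallLine _ _ _ _, ?_⟩
        obtain ⟨y, hy, hyv⟩ := root hv hv0
        refine ⟨(z + t) * y, y, fun h => hy (by simpa using congrFun h 1), ?_⟩
        refine mk_eq_of_smul _ _ y⁻¹ fun i => ?_
        fin_cases i <;> simp [mul_pow, hf.add, hyv, hy] <;> field_simp
        simp only [Set.mem_ofPred_eq] at ht
        field_simp at ht
        linear_combination -ht
  rw [hset]
  refine ncard_insert_image _ _ _ (hf.ncard_eq_mul_pow hw) hf.ne_zero ?_ ?_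
  · intro t t' h
    obtain ⟨a, -, hi⟩ := exists_smul_of_mk_eq h
    have h0 := hi 0
    have h1 := hi 1
    simp at h0 h1
    subst h1
    linear_combination -h0
  · intro t _ h
    obtain ⟨a, -, hi⟩ := exists_smul_of_mk_eq h
    have h1 := hi 1
    simp at h1

lemma pencil_diff_eq (hf : QFrob q F) {α u v : F} (hα : α ≠ 0) (hu : u ^ (q + 1) = 1)
    (hv : v ^ (q + 1) = 1) (ℓ : Set (Pt F)) :
    ℓ ∈ pencil q F α u v \ {rU1 F} ↔ ∃ z, ℓ = hallLine q (α * u) (v / u) z := by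
  have hu0 : u ≠ 0 := fun h => by simp [h] at hu
  have hμ : α * u * (v / u) = α * v := by field_simp
  constructor
  · rintro ⟨⟨⟨W, hW, hℓ⟩, hP, hplane, hcard⟩, hne⟩
    change ℓ = ptsOf W at hℓ
    subst hℓ
    rw [Ppt, mk_mem_ptsOf] at hP
    have hW3 : ∀ x ∈ W, x 3 = α * v * x 1 := by
      intro x hx
      by_cases hx0 : x = 0
      · simp [hx0]
      · exact mem_planeSet_mk.1 (hplane (mk_mem_ptsOf (hv := hx0).2 hx))
    obtain ⟨R, ⟨hRW, x, y, hxy, rfl⟩, hRne⟩ :=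
      Set.exists_ne_of_one_lt_ncard (by rw [hcard]; have := hf.ne_zero; omega) (Ppt F α u)
    rw [mk_mem_ptsOf] at hRW
    have hp := hW3 _ hRW
    simp only [Matrix.cons_val] at hp
    by_cases hy : y = 0
    · exfalso
      subst hy
      have hx : x ≠ 0 := by
        rintro rfl
        apply hxy
        funext i
        fin_cases i <;> simp [hf.ne_zero]
      have hdet : α * x ^ q - α * u * x ≠ 0 := by
        intro h
        apply hRne
        refine mk_eq_of_smul _ _ x fun i => ?_
        fin_cases i <;> simp [hf.ne_zero]
        linear_combination -h
      apply hne
      have hWs := eq_span_pair hW hP hRW (by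
        intro s t h
        have h0 := congrFun h 0
        have h2 := congrFun h 2
        simp at h0 h2
        have ht : t = 0 := by
          have : t * (α * x ^ q - α * u * x) = 0 := by linear_combination h2 - α * u * h0
          exact (mul_eq_zero.1 this).resolve_right hdet
        subst ht
        simpa using h0)
      rw [Set.mem_singleton_iff]
      ext Q
      induction Q using Projectivization.ind with
      | h k hk =>
        rw [mk_mem_ptsOf, mem_rU1_mk, hWs, mem_span_pair_vec]
        simp only [forall_fin_four, Matrix.cons_val, hf.zero_pow, mul_zero, add_zero, mul_one]
        constructor
        · rintro ⟨s, t, -, h1, -, h3⟩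
          exact ⟨h1.symm, h3.symm⟩
        · rintro ⟨h1, h3⟩
          refine ⟨k 0 - (k 2 - α * u * k 0) / (α * x ^ q - α * u * x) * x,
            (k 2 - α * u * k 0) / (α * x ^ q - α * u * x), by ring, h1.symm, ?_, h3.symm⟩
          have h2 := div_mul_cancel₀ (k 2 - α * u * k 0) hdet
          linear_combination h2
    · refine ⟨x / y, ?_⟩
      have hyq : y ^ q = v * y := by
        apply mul_left_cancel₀ hα
        linear_combination hp
      rw [hallLine, hμ]
      congr 1
      refine eq_span_pair hW hP ?_ (hallLine_indep _ _ _ _)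
      have : ![x / y, 1, α * v * (x / y) ^ q, α * v] =
          y⁻¹ • ![x, y, α * x ^ q, α * y ^ q] := by
        have hv0 : v ≠ 0 := fun h => by simp [h] at hv
        funext i
        fin_cases i <;> simp [div_pow, hyq] <;> field_simp
      rw [this]
      exact W.smul_mem _ hRW
  · rintro ⟨z, rfl⟩
    refine ⟨⟨isLine_span_pair (hallLine_indep _ _ _ _), inf_mem_hallLine _ _ _, ?_,
      hallLine_inter_sigma hf hα hu hv z⟩, ?_⟩
    · intro P hP
      induction P using Projectivization.ind with
      | h k hk =>
        rw [mem_planeSet_mk, ← hμ]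
        exact (mk_mem_hallLine.1 hP).1
    · intro h
      rw [Set.mem_singleton_iff] at h
      have h1 := affine_mem_hallLine (q := q) (α * u) (v / u) z 0
      rw [h, mem_rU1_mk] at h1
      simp at h1

end Pencil

section Translation

variable {q : ℕ} {F : Type} [Field F]

lemma gFun_gFun (hf : QFrob q F) (b : F) (v : Fin 4 → F) : gFun q F b (gFun q F (-b) v) = v := by
  have hb : (-b) ^ q = -b ^ q := by
    have := hf.sub 0 b
    rwa [zero_sub, hf.zero_pow, zero_sub] at this
  funext i
  fin_cases i <;> simp [gFun, hb]

/-- `gFun` as a linear equivalence. -/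
def gEquiv (hf : QFrob q F) (b : F) : (Fin 4 → F) ≃ₗ[F] (Fin 4 → F) where
  toFun := gFun q F b
  map_add' v w := by
    funext i
    fin_cases i <;> simp [gFun] <;> ring
  map_smul' a v := by
    funext i
    fin_cases i <;> simp [gFun] <;> ring
  invFun := gFun q F (-b)
  left_inv v := by simpa using gFun_gFun hf (-b) v
  right_inv v := gFun_gFun hf b v

lemma gFun_ne_zero (hf : QFrob q F) (b : F) {v : Fin 4 → F} (hv : v ≠ 0) : gFun q F b v ≠ 0 :=
  (gEquiv hf b).map_ne_zero_iff.2 hv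

lemma gmap_mk (hf : QFrob q F) (b : F) {v : Fin 4 → F} (hv : v ≠ 0) :
    gmap q F b (Projectivization.mk F v hv) = Projectivization.mk F _ (gFun_ne_zero hf b hv) := by
  obtain ⟨a, ha, h⟩ := exists_rep_smul v hv
  rw [gmap, dif_pos (gFun_ne_zero hf b (Projectivization.rep_nonzero _))]
  refine mk_eq_of_smul _ _ a fun i => ?_
  fin_cases i <;> simp [gFun, h] <;> ring

lemma gmap_gmap_neg (hf : QFrob q F) (b : F) (P : Pt F) : gmap q F b (gmap q F (-b) P) = P := by
  induction P using Projectivization.ind with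
  | h v hv =>
    rw [gmap_mk hf, gmap_mk hf]
    simp only [gFun_gFun hf]

lemma gmap_neg_gmap (hf : QFrob q F) (b : F) (P : Pt F) : gmap q F (-b) (gmap q F b P) = P := by
  simpa using gmap_gmap_neg hf (-b) P

lemma gmap_injective (hf : QFrob q F) (b : F) : Function.Injective (gmap q F b) :=
  Function.LeftInverse.injective (gmap_neg_gmap hf b)

lemma image_gmap_gmap_neg (hf : QFrob q F) (b : F) (A : Set (Pt F)) :
    gmap q F b '' (gmap q F (-b) '' A) = A := by
  rw [Set.image_image]
  simp [gmap_gmap_neg hf]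

lemma image_gmap_neg_gmap (hf : QFrob q F) (b : F) (A : Set (Pt F)) :
    gmap q F (-b) '' (gmap q F b '' A) = A := by
  simpa using image_gmap_gmap_neg hf (-b) A

/-- To compute images under all `gmap`s it suffices to prove inclusions. -/
lemma image_gmap_eq (hf : QFrob q F) {b : F} {A B : Set (Pt F)}
    (h : ∀ P ∈ A, gmap q F b P ∈ B) (h' : ∀ P ∈ B, gmap q F (-b) P ∈ A) :
    gmap q F b '' A = B := by
  refine Set.Subset.antisymm ?_ fun P hP => ⟨_, h' P hP, gmap_gmap_neg hf b P⟩
  rintro _ ⟨P, hP, rfl⟩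
  exact h P hP

lemma tau_gmap (hf : QFrob q F) (b : F) (P : Pt F) :
    tau q F 1 (gmap q F b P) = gmap q F b (tau q F 1 P) := by
  induction P using Projectivization.ind with
  | h v hv =>
    rw [gmap_mk hf, tau_mk, tau_mk, gmap_mk hf]
    refine mk_eq_of_smul _ _ 1 fun i => ?_
    fin_cases i <;> simp [tauFun_one, gFun, hf.add, mul_pow, hf.invol]

lemma gmap_mem_sigma (hf : QFrob q F) (b : F) {P : Pt F} (h : P ∈ SigmaSet q F 1) :
    gmap q F b P ∈ SigmaSet q F 1 := by
  obtain ⟨x, y, h, rfl⟩ := h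
  rw [gmap_mk hf]
  have he : gFun q F b ![x, y, 1 * x ^ q, 1 * y ^ q] =
      ![x + b * y, y, 1 * (x + b * y) ^ q, 1 * y ^ q] := by
    funext i
    fin_cases i <;> simp [gFun, hf.add, mul_pow]
  refine ⟨x + b * y, y, ?_, ?_⟩
  · rw [← he]
    exact gFun_ne_zero hf b h
  · simp only [he]

lemma gmap_mem_lineThrough (hf : QFrob q F) (b : F) {A B P : Pt F} (h : P ∈ lineThrough F A B) :
    gmap q F b P ∈ lineThrough F (gmap q F b A) (gmap q F b B) := by
  induction A using Projectivization.ind with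
  | h v hv =>
  induction B using Projectivization.ind with
  | h w hw =>
  induction P using Projectivization.ind with
  | h x hx =>
    rw [mk_mem_lineThrough] at h
    obtain ⟨s, t, h⟩ := h
    rw [gmap_mk hf, gmap_mk hf, gmap_mk hf, mk_mem_lineThrough]
    refine ⟨s, t, fun i => ?_⟩
    fin_cases i <;> simp [gFun, ← h] <;> ring

lemma gmap_mem_tauLine (hf : QFrob q F) (b : F) {Q P : Pt F} (h : P ∈ tauLine q Q) :
    gmap q F b P ∈ tauLine q (gmap q F b Q) := by
  refine ⟨?_, gmap_mem_sigma hf b h.2⟩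
  rw [tau_gmap hf]
  exact gmap_mem_lineThrough hf b h.1

lemma image_tauLine (hf : QFrob q F) (b : F) (Q : Pt F) :
    gmap q F b '' tauLine q Q = tauLine q (gmap q F b Q) := by
  refine image_gmap_eq hf (fun P hP => gmap_mem_tauLine hf b hP) fun P hP => ?_
  simpa [gmap_neg_gmap hf] using gmap_mem_tauLine hf (-b) hP

lemma image_mem_Sspread (hf : QFrob q F) (b : F) {ℓ m : Set (Pt F)}
    (h : m ∈ Sspread q F 1 ℓ) : gmap q F b '' m ∈ Sspread q F 1 (gmap q F b '' ℓ) := by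
  obtain ⟨Q, hQ, rfl⟩ := h
  exact ⟨_, ⟨Q, hQ, rfl⟩, image_tauLine hf b Q⟩

lemma image_mem_Dspread (hf : QFrob q F) (b : F) {m : Set (Pt F)}
    (h : m ∈ Dspread q F 1) : gmap q F b '' m ∈ Dspread q F 1 := by
  obtain ⟨Q, hQ, rfl⟩ := h
  refine ⟨gmap q F b Q, ?_, image_tauLine hf b Q⟩
  induction Q using Projectivization.ind with
  | h v hv =>
    rw [mem_t1_mk] at hQ
    rw [gmap_mk hf, mem_t1_mk]
    simp [gFun, hQ]

lemma image_mem_Rreg (hf : QFrob q F) (b : F) {ℓ m : Set (Pt F)}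
    (h : m ∈ Rreg q F 1 ℓ) : gmap q F b '' m ∈ Rreg q F 1 (gmap q F b '' ℓ) :=
  ⟨image_mem_Dspread hf b h.1, image_mem_Sspread hf b h.2⟩

lemma mem_Rreg_of_image (hf : QFrob q F) (b : F) {ℓ m : Set (Pt F)}
    (h : m ∈ Rreg q F 1 (gmap q F b '' ℓ)) : gmap q F (-b) '' m ∈ Rreg q F 1 ℓ := by
  simpa [image_gmap_neg_gmap hf] using image_mem_Rreg hf (-b) h

lemma image_isLineOfSigma (hf : QFrob q F) (b : F) {m : Set (Pt F)}
    (h : IsLineOfSigma q F 1 m) : IsLineOfSigma q F 1 (gmap q F b '' m) := by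
  obtain ⟨_, ⟨W, hW, rfl⟩, rfl, hcard⟩ := h
  change (ptsOf W ∩ _).ncard = q + 1 at hcard
  refine ⟨ptsOf (W.map (gEquiv hf b : (Fin 4 → F) →ₗ[F] (Fin 4 → F))), ⟨_, ?_, rfl⟩, ?_, ?_⟩
  · rw [LinearEquiv.finrank_map_eq, hW]
  · have h1 : gmap q F b '' ptsOf W =
        ptsOf (W.map (gEquiv hf b : (Fin 4 → F) →ₗ[F] (Fin 4 → F))) := by
      refine image_gmap_eq hf (fun P hP => ?_) fun P hP => ?_
      · induction P using Projectivization.ind with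
        | h v hv =>
          rw [gmap_mk hf, mk_mem_ptsOf]
          exact ⟨v, mk_mem_ptsOf.1 hP, rfl⟩
      · induction P using Projectivization.ind with
        | h v hv =>
          rw [mk_mem_ptsOf] at hP
          obtain ⟨k, hk, rfl⟩ := hP
          rw [gmap_mk hf, mk_mem_ptsOf]
          have : gFun q F (-b) (gFun q F b k) = k := (gEquiv hf b).left_inv k
          change gFun q F (-b) (gFun q F b k) ∈ W
          rwa [this]
    change gmap q F b '' (ptsOf W ∩ _) = _
    rw [Set.image_inter (gmap_injective hf b), h1]
    congr 1
    exact image_gmap_eq hf (fun P => gmap_mem_sigma hf b) fun P => gmap_mem_sigma hf (-b)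
  · rw [Set.ncard_image_of_injective _ (gmap_injective hf b)]
    exact hcard

lemma image_mem_hallSpread (hf : QFrob q F) (b : F) {ℓ m : Set (Pt F)}
    (h : m ∈ hallSpread q ℓ) : gmap q F b '' m ∈ hallSpread q (gmap q F b '' ℓ) := by
  rcases h with ⟨hS, hR⟩ | ⟨hl, ho⟩
  · refine Or.inl ⟨image_mem_Sspread hf b hS, fun h => hR ?_⟩
    simpa [image_gmap_neg_gmap hf] using mem_Rreg_of_image hf b h
  · refine Or.inr ⟨image_isLineOfSigma hf b hl, fun m' hm' => ?_⟩
    obtain ⟨P, hP, hP'⟩ := ho _ (mem_Rreg_of_image hf b hm')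
    refine ⟨gmap q F b P, ⟨P, hP, rfl⟩, ?_⟩
    rw [← image_gmap_gmap_neg hf b m']
    exact ⟨P, hP', rfl⟩

lemma image_hallSpread (hf : QFrob q F) (b : F) (ℓ : Set (Pt F)) :
    (fun m => gmap q F b '' m) '' hallSpread q ℓ = hallSpread q (gmap q F b '' ℓ) := by
  refine Set.Subset.antisymm ?_ fun m hm => ?_
  · rintro _ ⟨m, hm, rfl⟩
    exact image_mem_hallSpread hf b hm
  · refine ⟨gmap q F (-b) '' m, ?_, image_gmap_gmap_neg hf b m⟩
    simpa [image_gmap_neg_gmap hf] using image_mem_hallSpread hf (-b) hm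

lemma image_hallLine (hf : QFrob q F) (b c w z : F) :
    gmap q F b '' hallLine q c w z = hallLine q c w (z + b) := by
  have key (b z : F) : ∀ P ∈ hallLine q c w z, gmap q F b P ∈ hallLine q c w (z + b) := by
    intro P hP
    induction P using Projectivization.ind with
    | h v hv =>
      rw [mk_mem_hallLine] at hP
      rw [gmap_mk hf, mk_mem_hallLine]
      simp only [gFun, Matrix.cons_val, hP, hf.add, true_and]
      ring
  refine image_gmap_eq hf (key b z) fun P hP => ?_
  simpa using key (-b) _ P hP

end Translation

section Classification

variable {q : ℕ} {F : Type} [Field F]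

lemma secLine_ne (hf : QFrob q F) {d : F} (hd : d ^ q ≠ d) (z : F) :
    secLine q d z ≠ secLine q 1 z := by
  have hd0 : d ≠ 0 := by
    rintro rfl
    exact hd hf.zero_pow
  intro h
  have h1 := secLine_bMem (k := 0) hf hd0 z (by rw [zero_div, hf.zero_pow])
  rw [h, bMem_secLine hf one_ne_zero h1.1] at h1
  obtain ⟨s, t, -, ht, -, h2⟩ := h1
  rw [inv_one, mul_one] at h2
  rw [← h2, inv_pow] at ht
  exact hd (inv_injective ht)

lemma exists_two_affine_mem_Rreg (hf : QFrob q F) {ℓ : Set (Pt F)}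
    (hS : IsSpreadOfSigma q F 1 (hallSpread q ℓ)) :
    ∃ z₁ z₂ : F, z₁ ≠ z₂ ∧ desLine q z₁ 1 ∈ Rreg q F 1 ℓ ∧ desLine q z₂ 1 ∈ Rreg q F 1 ℓ := by
  by_contra! hcon
  have hz : ∃ z : F, ∀ z', desLine q z' 1 ∈ Rreg q F 1 ℓ → z' = z := by
    by_cases h : ∃ z, desLine q z 1 ∈ Rreg q F 1 ℓ
    · obtain ⟨z, h⟩ := h
      refine ⟨z, fun z' h' => ?_⟩
      by_contra hne
      exact hcon z' z hne h' h
    · push Not at h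
      exact ⟨0, fun z' h' => (h z' h').elim⟩
  obtain ⟨z, hz⟩ := hz
  have mem {d : F} (hd : d ≠ 0) : secLine q d z ∈ hallSpread q ℓ := by
    refine Or.inr ⟨secLine_isLine hf hd z, fun m hm => ?_⟩
    rcases mem_Dspread_cases hf hm.1 with rfl | ⟨z', rfl⟩
    · exact (secLine_bMem_inf hf hd z).inter ((bMem_desLine (by simp)).2 (by simp))
    · obtain rfl := hz z' hm
      exact (secLine_bMem (k := 0) hf hd z' (by rw [zero_div, hf.zero_pow])).inter
        ((bMem_desLine (by simp [hd])).2 (by ring))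
  obtain ⟨g, hg⟩ := hf.exists_not_fixed
  have hg0 : g ≠ 0 := by
    rintro rfl
    exact hg hf.zero_pow
  have h := (secLine_bMem_inf hf hg0 z).inter (secLine_bMem_inf hf one_ne_zero z)
  rw [hS.2.1 _ (mem hg0) _ (mem one_ne_zero) (secLine_ne hf hg z)] at h
  exact Set.not_nonempty_empty h

/-- Switching the whole Desarguesian spread does not give a spread. -/
lemma not_isSpread_of_Sspread_eq (hf : QFrob q F) {ℓ : Set (Pt F)}
    (hsub : Sspread q F 1 ℓ ⊆ Dspread q F 1) (hall : ∀ z, desLine q z 1 ∈ Sspread q F 1 ℓ) :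
    ¬ IsSpreadOfSigma q F 1 (hallSpread q ℓ) := by
  intro hS
  have h10 : (1 : F) ≠ 0 ∨ (0 : F) ≠ 0 := Or.inl one_ne_zero
  have hP := mk_mem_sigma hf h10
  rw [← hS.2.2] at hP
  obtain ⟨m, hm, hP⟩ := hP
  have hinf : BMem q m 1 0 := ⟨h10, hP⟩
  rcases hm with ⟨h1, h2⟩ | hm
  · exact h2 ⟨hsub h1, h1⟩
  · have meet (z : F) := exists_bMem_of_meets (hm.2 _ ⟨hsub (hall z), hall z⟩)
    obtain ⟨g, hg⟩ := hf.exists_not_fixed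
    obtain ⟨a₀, ha₀, h₀⟩ := meet 0
    obtain ⟨a₁, ha₁, h₁⟩ := meet 1
    obtain ⟨a₂, ha₂, h₂⟩ := meet g
    have := hm.1.ratio_fixed hf ha₀ ha₁ ha₂ hinf h₀ h₁ h₂ one_ne_zero
    simp only [sub_zero, div_one] at this
    exact hg this

lemma not_isSpread_of_t1 (hf : QFrob q F) {W : Submodule F (Fin 4 → F)}
    (h : ∀ v, v ∈ W ↔ v 2 = 0 ∧ v 3 = 0) :
    ¬ IsSpreadOfSigma q F 1 (hallSpread q (ptsOf W)) := by
  refine not_isSpread_of_Sspread_eq hf ?_ fun z => ?_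
  · rintro _ ⟨Q, hQ, rfl⟩
    refine ⟨Q, ?_, rfl⟩
    induction Q using Projectivization.ind with
    | h v hv => exact mem_t1_mk.2 ((h v).1 (mk_mem_ptsOf.1 hQ))
  · refine ⟨Projectivization.mk F ![z, 1, 0, 0] (vec_ne_zero_snd _ _ _), ?_, ?_⟩
    · rw [mk_mem_ptsOf, h]
      simp
    · exact (tauLine_t1 hf (a := z) (b := 1) (by simp) _ rfl rfl rfl rfl).symm

lemma not_isSpread_of_t2 (hf : QFrob q F) {W : Submodule F (Fin 4 → F)}
    (h : ∀ v, v ∈ W ↔ v 0 = 0 ∧ v 1 = 0) :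
    ¬ IsSpreadOfSigma q F 1 (hallSpread q (ptsOf W)) := by
  refine not_isSpread_of_Sspread_eq hf ?_ fun z => ?_
  · rintro _ ⟨Q, hQ, rfl⟩
    refine ⟨tau q F 1 Q, ?_, (tauLine_tau hf Q).symm⟩
    induction Q using Projectivization.ind with
    | h v hv =>
      obtain ⟨h0, h1⟩ := (h v).1 (mk_mem_ptsOf.1 hQ)
      rw [tau_mk, mem_t1_mk]
      simp [tauFun_one, h0, h1, hf.ne_zero]
  · refine ⟨tau q F 1 (Projectivization.mk F ![z, 1, 0, 0] (vec_ne_zero_snd _ _ _)), ?_, ?_⟩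
    · rw [tau_mk, mk_mem_ptsOf, h]
      simp [tauFun_one, hf.ne_zero]
    · refine Eq.trans ?_ (tauLine_tau hf _).symm
      exact (tauLine_t1 hf (a := z) (b := 1) (by simp) _ rfl rfl rfl rfl).symm

/-- The lines whose Hall spread is a spread switching a regulus through `desLine q 1 0`. -/
lemma exists_eq_hallLine (hf : QFrob q F) {ℓ : Set (Pt F)} (hℓ : isLine F ℓ)
    (hdisj : ℓ ∩ tau q F 1 '' ℓ = ∅) (hr : desLine q 1 0 ∈ Rreg q F 1 ℓ)
    (hS : IsSpreadOfSigma q F 1 (hallSpread q ℓ)) :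
    ∃ c w z : F, HallParam q c w ∧ ℓ = hallLine q c w z := by
  obtain ⟨z₁, z₂, hz, hm₁, hm₂⟩ := exists_two_affine_mem_Rreg hf hS
  obtain ⟨W, hW, rfl⟩ := hℓ
  change IsSpreadOfSigma q F 1 (hallSpread q (ptsOf W)) at hS
  change ptsOf W ∩ tau q F 1 '' ptsOf W = ∅ at hdisj
  change ∃ c w z : F, HallParam q c w ∧ ptsOf W = hallLine q c w z
  have point {a b : F} (h : desLine q a b ∈ Rreg q F 1 (ptsOf W)) :
      ∃ v ∈ W, v ≠ 0 ∧ v 0 * b = v 1 * a ∧ v 2 * b ^ q = v 3 * a ^ q := by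
    obtain ⟨-, Q, hQ, hmQ⟩ := h
    induction Q using Projectivization.ind with
    | h v hv => exact ⟨v, mk_mem_ptsOf.1 hQ, hv, of_tauLine_eq_desLine hf hv hmQ.symm⟩
  obtain ⟨e, heW, he, he1, he3⟩ := point hr
  obtain ⟨f, hfW, hf0, hf1, hf3⟩ := point hm₁
  obtain ⟨k, hkW, hk0, hk1, hk3⟩ := point hm₂
  simp only [hf.zero_pow, mul_zero, one_pow, mul_one] at he1 he3 hf1 hf3 hk1 hk3
  have hfab : f 1 ≠ 0 ∨ f 3 ≠ 0 := by
    by_contra! h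
    exact hf0 (vec4_eq_zero (by rw [hf1, h.1, zero_mul]) h.1 (by rw [hf3, h.2, zero_mul]) h.2)
  have hindep : ∀ s t : F, s • e + t • f = 0 → s = 0 ∧ t = 0 := by
    intro s t h
    have h1 := congrFun h 1
    have h3 := congrFun h 3
    simp [← he1, ← he3] at h1 h3
    have ht : t = 0 := by
      rcases hfab with h | h
      · exact h1.resolve_right h
      · exact h3.resolve_right h
    subst ht
    simp only [zero_smul, add_zero, smul_eq_zero] at h
    exact ⟨h.resolve_right he, rfl⟩
  have hWs := eq_span_pair hW heW hfW hindep
  rw [hWs, mem_span_pair_vec] at hkW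
  obtain ⟨r, s, hrs⟩ := hkW
  rw [forall_fin_four, ← he1, ← he3] at hrs
  obtain ⟨h0, h1, h2, h3⟩ := hrs
  simp only [mul_zero, zero_add] at h1 h3
  have hk_fst : s * f 1 * (z₂ - z₁) = r * e 0 := by
    rw [hk1, hf1, ← h1] at h0
    linear_combination -h0
  have hk_snd : s * f 3 * (z₂ - z₁) ^ q = r * e 2 := by
    rw [hk3, hf3, ← h3] at h2
    rw [hf.sub]
    linear_combination -h2
  have hzz : z₂ - z₁ ≠ 0 := sub_ne_zero.2 hz.symm
  have hzq : (z₂ - z₁) ^ q ≠ 0 := pow_ne_zero q hzz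
  have hs : s ≠ 0 := by
    rintro rfl
    rw [zero_mul] at h1 h3
    exact hk0 (vec4_eq_zero (by rw [hk1, ← h1, zero_mul]) h1.symm
      (by rw [hk3, ← h3, zero_mul]) h3.symm)
  have hr0 : r ≠ 0 := by
    rintro rfl
    simp [hs, hzz, hzq] at hk_fst hk_snd
    rcases hfab with h | h
    · exact h hk_fst
    · exact h hk_snd
  have he02 : e 0 ≠ 0 ∨ e 2 ≠ 0 := by
    by_contra! h
    exact he (vec4_eq_zero h.1 he1.symm h.2 he3.symm)
  by_cases hx1 : e 0 = 0
  · exfalso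
    have hx3 := he02.resolve_left (not_not.2 hx1)
    have hf10 : f 1 = 0 := by simpa [hx1, hs, hzz] using hk_fst
    have hf30 := hfab.resolve_left (not_not.2 hf10)
    refine not_isSpread_of_t2 hf (W := W) (fun v => ?_) hS
    rw [hWs, mem_span_pair_vec]
    simp only [forall_fin_four, hx1, hf1, hf10, ← he1, ← he3, hf3]
    constructor
    · rintro ⟨s, t, h0, h1, -⟩
      simpa [eq_comm] using And.intro h0 h1
    · rintro ⟨h0, h1⟩
      refine ⟨(v 2 - v 3 * z₁ ^ q) / e 2, v 3 / f 3, ?_, ?_, ?_, ?_⟩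
      · rw [h0]; ring
      · rw [h1]; ring
      · field_simp; ring
      · field_simp; ring
  by_cases hx3 : e 2 = 0
  · exfalso
    have hf30 : f 3 = 0 := by simpa [hx3, hs, hzq] using hk_snd
    have hf10 := hfab.resolve_right (not_not.2 hf30)
    refine not_isSpread_of_t1 hf (W := W) (fun v => ?_) hS
    rw [hWs, mem_span_pair_vec]
    simp only [forall_fin_four, hx3, hf1, hf30, ← he1, ← he3, hf3]
    constructor
    · rintro ⟨s, t, -, -, h0, h1⟩
      simpa [eq_comm] using And.intro h0 h1
    · rintro ⟨h0, h1⟩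
      refine ⟨(v 0 - v 1 * z₁) / e 0, v 1 / f 1, ?_, ?_, ?_, ?_⟩
      · field_simp; ring
      · field_simp; ring
      · rw [h0]; ring
      · rw [h1]; ring
  have hf10 : f 1 ≠ 0 := fun h => by simp [h, hr0, hx1] at hk_fst
  have hc : e 2 / e 0 ≠ 0 := div_ne_zero hx3 hx1
  have hw : e 2 / e 0 * ((z₂ - z₁) / (z₂ - z₁) ^ q) = f 3 / f 1 := by
    field_simp
    apply mul_left_cancel₀ (mul_ne_zero hr0 hs)
    linear_combination s * f 3 * (z₂ - z₁) ^ q * hk_fst - s * f 1 * (z₂ - z₁) * hk_snd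
  have hline : ptsOf W = hallLine q (e 2 / e 0) ((z₂ - z₁) / (z₂ - z₁) ^ q) z₁ := by
    rw [hallLine, hw]
    congr 1
    refine eq_span_pair hW ?_ ?_ (hallLine_indep _ _ _ _)
    · have : ![1, 0, e 2 / e 0, 0] = (e 0)⁻¹ • e := by
        funext i
        fin_cases i <;> simp [← he1, ← he3, hx1]
        field_simp
      rw [this]
      exact W.smul_mem _ heW
    · have : ![z₁, 1, f 3 / f 1 * z₁ ^ q, f 3 / f 1] = (f 1)⁻¹ • f := by
        funext i
        fin_cases i <;> simp [hf1, hf3, hf10] <;> field_simp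
      rw [this]
      exact W.smul_mem _ hfW
  refine ⟨_, _, z₁, ⟨hc, fun hN => ?_, ?_⟩, hline⟩
  · have hP := inf_mem_hallLine (q := q) (e 2 / e 0) ((z₂ - z₁) / (z₂ - z₁) ^ q) z₁
    rw [← hline] at hP
    have : Projectivization.mk F ![1, 0, e 2 / e 0, 0] (vec4_ne_zero_fst F _ _ _ _ one_ne_zero) ∈
        ptsOf W ∩ tau q F 1 '' ptsOf W := by
      refine ⟨hP, _, hP, ?_⟩
      rw [tau_mk]
      refine mk_eq_of_smul _ _ ((e 2 / e 0) ^ q) fun i => ?_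
      fin_cases i <;> simp only [tauFun_one] <;> simp [hf.ne_zero]
      linear_combination -hN
    rw [hdisj] at this
    exact this
  · rw [pow_succ, div_pow, hf.invol]
    field_simp

end Classification

section Separation

variable {q : ℕ} {F : Type} [Field F]

lemma affine_tauLine_notMem_Dspread (hf : QFrob q F) {p r μ : F}
    (hB : r ^ q - p * μ ^ q ≠ 0) :
    tauLine q (Projectivization.mk F ![p, 1, r, μ] (vec_ne_zero_snd _ _ _)) ∉ Dspread q F 1 := by
  intro h
  rcases mem_Dspread_cases hf h with h | ⟨z, h⟩
  · have := (of_tauLine_eq_desLine hf _ h).1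
    simp at this
  · obtain ⟨h1, h2⟩ := of_tauLine_eq_desLine hf _ h
    simp only [Matrix.cons_val, mul_one, one_mul, one_pow] at h1 h2
    apply hB
    rw [h1, h2, mul_pow, hf.invol]
    ring

/-- If the pencils attached to `(c, w)` and `(c', w')` are not in general position, suitable Hall
spreads attached to them share an unswitched line. -/
lemma exists_common_line (hf : QFrob q F) {c w c' w' : F} (h : HallParam q c w)
    (h' : HallParam q c' w') (heq : c * (c' * w') ^ q = (c * w) ^ q * c') :
    ∃ z z' m, m ∈ hallSpread q (hallLine q c w z) ∧ m ∈ hallSpread q (hallLine q c' w' z') := by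
  obtain ⟨t, ht⟩ : ∃ t : F, -(c * w) ^ q * t + c ^ q * t ^ q ≠ 0 := by
    by_contra! h0
    exact pow_ne_zero q h.ne_zero (hf.coeff_eq_zero h0).2
  have hN := h.norm_mul
  have hN' := h'.norm_mul
  have hc' := h'.ne_zero
  generalize hμ : c * w = μ at *
  generalize hμ' : c' * w' = μ' at *
  have fixed (x : F) : (1 - x ^ q * x) ^ q = 1 - x ^ q * x := by
    rw [hf.sub, mul_pow, hf.invol, one_pow, mul_comm]
  obtain ⟨κ, hκ⟩ : ∃ κ, κ = (1 - μ' ^ q * μ') / (1 - μ ^ q * μ) := ⟨_, rfl⟩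
  have hκq : κ ^ q = κ := by rw [hκ, div_pow, fixed, fixed]
  have hκN : κ * (1 - μ ^ q * μ) = 1 - μ' ^ q * μ' := by
    rw [hκ, div_mul_cancel₀ _ hN]
  obtain ⟨t', ht'⟩ : ∃ t', t' = κ * (c / c') * t := ⟨_, rfl⟩
  have ht'q : t' ^ q * c' ^ q = κ * c ^ q * t ^ q := by
    rw [ht', mul_pow, mul_pow, hκq, div_pow]
    have := pow_ne_zero q hc'
    field_simp
  have ht'μ : t' * μ' ^ q = κ * μ ^ q * t := by
    rw [ht']
    field_simp
    linear_combination κ * t * heq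
  obtain ⟨A, hA⟩ : ∃ A, A * (1 - μ ^ q * μ) = t - t ^ q * c ^ q * μ :=
    ⟨_, div_mul_cancel₀ _ hN⟩
  obtain ⟨z', hz'⟩ : ∃ z', (A - z') * (1 - μ' ^ q * μ') = t' - t' ^ q * c' ^ q * μ' :=
    ⟨A - (t' - t' ^ q * c' ^ q * μ') / (1 - μ' ^ q * μ'), by
      rw [sub_sub_cancel, div_mul_cancel₀ _ hN']⟩
  have hQ := affine_mem_hallLine (q := q) c w 0 t
  have hQ' := affine_mem_hallLine (q := q) c' w' z' t'
  rw [hμ, hf.zero_pow, mul_zero, zero_add, zero_add] at hQ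
  rw [hμ'] at hQ'
  have hD : tauLine q (Projectivization.mk F ![t, 1, t * c, μ] (vec_ne_zero_snd _ _ _)) ∉
      Dspread q F 1 := by
    refine affine_tauLine_notMem_Dspread hf fun h0 => ht ?_
    rw [mul_pow] at h0
    linear_combination h0
  have hm : tauLine q (Projectivization.mk F ![t, 1, t * c, μ] (vec_ne_zero_snd _ _ _)) =
      tauLine q (Projectivization.mk F ![z' + t', 1, μ' * z' ^ q + t' * c', μ']
        (vec_ne_zero_snd _ _ _)) := by
    refine eq_of_bMem_iff hf Set.inter_subset_right Set.inter_subset_right fun x y hxy => ?_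
    rw [bMem_tauLine_affine hf hN _ rfl rfl rfl rfl hxy,
      bMem_tauLine_affine hf hN' _ rfl rfl rfl rfl hxy]
    simp only [Matrix.cons_val]
    rw [hf.add, mul_pow, mul_pow, mul_pow, hf.invol, ← hκN]
    have key : (z' + t' - (μ' ^ q * z' + t' ^ q * c' ^ q) * μ') * y +
        (μ' ^ q * z' + t' ^ q * c' ^ q - (z' + t') * μ' ^ q) * y ^ q =
        κ * ((t - t ^ q * c ^ q * μ) * y + (t ^ q * c ^ q - t * μ ^ q) * y ^ q) := by
      linear_combination -y * hz' - y * A * hκN + κ * y * hA + y ^ q * (ht'q - ht'μ)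
    rw [key, mul_assoc κ]
    have hκ0 : κ ≠ 0 := by
      rintro rfl
      rw [zero_mul] at hκN
      exact hN' hκN.symm
    exact (mul_right_inj' hκ0).symm
  refine ⟨0, z', _, Or.inl ⟨⟨_, hQ, rfl⟩, fun h0 => hD h0.1⟩, Or.inl ⟨?_, fun h0 => hD h0.1⟩⟩
  exact ⟨_, hQ', hm⟩

end Separation

section Reduction

variable {q : ℕ} {F : Type} [Field F]

lemma isLineOfSigma_eq (hf : QFrob q F) {η : F} (hη : η ^ (q + 1) = 1) :
    IsLineOfSigma q F η = IsLineOfSigma q F 1 := by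
  funext m
  simp only [IsLineOfSigma, sigmaSet_eq hf hη]

lemma isParallelismOfSigma_eq (hf : QFrob q F) {η : F} (hη : η ^ (q + 1) = 1) :
    IsParallelismOfSigma q F η = IsParallelismOfSigma q F 1 := by
  funext Pl
  simp only [IsParallelismOfSigma, IsSpreadOfSigma, isLineOfSigma_eq hf hη, sigmaSet_eq hf hη]

lemma dspread_eq (hf : QFrob q F) {η : F} (hη : η ^ (q + 1) = 1) :
    Dspread q F η = Dspread q F 1 := by
  simp only [Dspread, sigmaSet_eq hf hη]

lemma sspread_eq (hf : QFrob q F) {η : F} (hη : η ^ (q + 1) = 1) :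
    Sspread q F η = Sspread q F 1 := by
  funext ℓ
  simp only [Sspread, sigmaSet_eq hf hη, tau_eq hη]

lemma rreg_eq (hf : QFrob q F) {η : F} (hη : η ^ (q + 1) = 1) :
    Rreg q F η = Rreg q F 1 := by
  funext ℓ
  simp only [Rreg, sspread_eq hf hη, dspread_eq hf hη]

lemma ropp_eq (hf : QFrob q F) {η : F} (hη : η ^ (q + 1) = 1) :
    Ropp q F η = Ropp q F 1 := by
  funext ℓ
  simp only [Ropp, isLineOfSigma_eq hf hη, rreg_eq hf hη]

lemma mem_ParP_iff (hf : QFrob q F) {η : F} (hη : η ^ (q + 1) = 1) {G : Finset (F × F × F)}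
    (hG : ∀ t ∈ G, t.1 ≠ 0 ∧ t.2.1 ^ (q + 1) = 1 ∧ t.2.2 ^ (q + 1) = 1)
    (S : Set (Set (Pt F))) : S ∈ ParP q F η G ↔
      (∃ t ∈ G, ∃ z, S = hallSpread q (hallLine q (t.1 * t.2.1) (t.2.2 / t.2.1) z)) ∨
        S = Dspread q F 1 := by
  simp only [ParP, dspread_eq hf hη, sspread_eq hf hη, rreg_eq hf hη, ropp_eq hf hη]
  refine or_congr ⟨?_, ?_⟩ Iff.rfl
  · rintro ⟨ℓ, hℓ, rfl⟩
    simp only [Lset, Set.mem_iUnion] at hℓ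
    obtain ⟨t, ht, hℓ⟩ := hℓ
    obtain ⟨h0, hu, hv⟩ := hG t ht
    obtain ⟨z, rfl⟩ := (pencil_diff_eq hf h0 hu hv ℓ).1 hℓ
    exact ⟨t, ht, z, rfl⟩
  · rintro ⟨t, ht, z, rfl⟩
    obtain ⟨h0, hu, hv⟩ := hG t ht
    refine ⟨_, ?_, rfl⟩
    simp only [Lset, Set.mem_iUnion]
    exact ⟨t, ht, (pencil_diff_eq hf h0 hu hv _).2 ⟨z, rfl⟩⟩

end Reduction

section Assembly

variable {q : ℕ} {F : Type} [Field F]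

lemma IsParallelismOfSigma.eq_of_mem {η : F} {Pl : Set (Set (Set (Pt F)))}
    (hpar : IsParallelismOfSigma q F η Pl) {S S' : Set (Set (Pt F))} (hS : S ∈ Pl) (hS' : S' ∈ Pl)
    {m : Set (Pt F)} (hm : m ∈ S) (hm' : m ∈ S') : S = S' :=
  (hpar.2 m ((hpar.1 S hS).1 m hm)).unique ⟨hS, hm⟩ ⟨hS', hm'⟩

lemma HallParam.inv (hf : QFrob q F) {c w : F} (h : HallParam q c w) : HallParam q (c ^ q)⁻¹ w := by
  have hc := h.ne_zero
  have hcq := pow_ne_zero q hc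
  refine ⟨inv_ne_zero hcq, fun h0 => h.norm_ne_one ?_, h.norm_dir⟩
  rw [inv_pow, hf.invol] at h0
  field_simp at h0
  linear_combination -h0

lemma IsIndexSet.exists_norm_eq (hf : QFrob q F) {I : Set F} (hI : IsIndexSet q F I) {c : F}
    (hc : c ≠ 0) (hN : 1 - c ^ q * c ≠ 0) :
    ∃ α ∈ I, α ^ (q + 1) = c ^ (q + 1) ∨ α ^ (q + 1) = ((c ^ q)⁻¹) ^ (q + 1) := by
  have hmem : c ^ (q + 1) ∈ FqSet q F \ {0} := by
    refine ⟨?_, pow_ne_zero _ hc⟩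
    change (c ^ (q + 1)) ^ q = c ^ (q + 1)
    rw [pow_succ, mul_pow, hf.invol, mul_comm]
  rw [← hI.2.2.2.2.1] at hmem
  rcases hmem with (⟨α, hα, h⟩ | ⟨_, ⟨α, hα, rfl⟩, h⟩) | h
  · exact ⟨α, hα, Or.inl h⟩
  · refine ⟨α, hα, Or.inr ?_⟩
    simp only at h
    rw [inv_eq_iff_eq_inv] at h
    rw [h, inv_pow, ← pow_mul, mul_comm, pow_mul, pow_succ c, mul_pow, hf.invol, mul_comm c]
  · rw [Set.mem_singleton_iff, pow_succ] at h
    exact (hN (by rw [h, sub_self])).elim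

/-- A translation invariant family of Hall spreads forming a parallelism contains, for every
direction `w`, all translates of some Hall spread with direction `w`. -/
lemma exists_hallSpread_mem (hf : QFrob q F) {I : Set F} (hI : IsIndexSet q F I)
    {Pl : Set (Set (Set (Pt F)))} (hpar : IsParallelismOfSigma q F 1 Pl)
    (hHall : ∀ S ∈ Pl, S ≠ Dspread q F 1 →
      ∃ c w z, HallParam q c w ∧ S = hallSpread q (hallLine q c w z))
    (hinv : ∀ b : F,
      (fun S : Set (Set (Pt F)) => (fun m : Set (Pt F) => gmap q F b '' m) '' S) '' Pl = Pl)
    {w : F} (hw : w ^ (q + 1) = 1) :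
    ∃ α u : F, α ∈ I ∧ u ^ (q + 1) = 1 ∧ HallParam q (α * u) w ∧
      ∀ z, hallSpread q (hallLine q (α * u) w z) ∈ Pl := by
  obtain ⟨d, hd, hdw⟩ := hf.exists_eq_mul_pow hw
  obtain ⟨S, ⟨hS, hdS⟩, -⟩ := hpar.2 _ (secLine_isLine hf hd 0)
  have hSD : S ≠ Dspread q F 1 := by
    rintro rfl
    exact secLine_notMem_Dspread hf hd 0 hdS
  obtain ⟨c, w', z₀, hp, rfl⟩ := hHall S hS hSD
  obtain rfl := dir_eq_of_secLine_mem hf hp hd hdw hdS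
  have hall (z : F) : hallSpread q (hallLine q c w z) ∈ Pl := by
    rw [← hinv (z - z₀)]
    refine ⟨_, hS, ?_⟩
    simp only [image_hallSpread hf, image_hallLine hf, add_sub_cancel]
  obtain ⟨α, hα, hN⟩ := hI.exists_norm_eq hf hp.ne_zero hp.norm_ne_one
  have hα0 : α ≠ 0 := by
    rintro rfl
    exact hI.1 hα
  obtain ⟨c', hc', hp', hall'⟩ : ∃ c', α ^ (q + 1) = c' ^ (q + 1) ∧ HallParam q c' w ∧
      ∀ z, hallSpread q (hallLine q c' w z) ∈ Pl := by
    rcases hN with hN | hN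
    · exact ⟨c, hN, hp, hall⟩
    · exact ⟨_, hN, hp.inv hf, fun z => by rw [hallSpread_inv hf hp.ne_zero hw]; exact hall z⟩
  refine ⟨α, c' / α, hα, ?_, ?_⟩
  · rw [div_pow, hc', div_self (pow_ne_zero _ hp'.ne_zero)]
  · rw [mul_div_cancel₀ _ hα0]
    exact ⟨hp', hall'⟩

lemma exists_isGoodSet [Fintype F] (hf : QFrob q F) {I : Set F} (hI : IsIndexSet q F I)
    {η : F} (hη : η ^ (q + 1) = 1)
    {Pl : Set (Set (Set (Pt F)))} (hpar : IsParallelismOfSigma q F 1 Pl)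
    (hD : Dspread q F 1 ∈ Pl)
    (hHall : ∀ S ∈ Pl, S ≠ Dspread q F 1 →
      ∃ c w z, HallParam q c w ∧ S = hallSpread q (hallLine q c w z))
    (hinv : ∀ b : F,
      (fun S : Set (Set (Pt F)) => (fun m : Set (Pt F) => gmap q F b '' m) '' S) '' Pl = Pl) :
    ∃ G : Finset (F × F × F), IsGoodSet q F I G ∧ Pl = ParP q F η G := by
  have hex : ∀ w : F, w ^ (q + 1) = 1 → ∃ α u : F, α ∈ I ∧ u ^ (q + 1) = 1 ∧
      HallParam q (α * u) w ∧ ∀ z, hallSpread q (hallLine q (α * u) w z) ∈ Pl :=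
    fun w hw => exists_hallSpread_mem hf hI hpar hHall hinv hw
  choose! α u hα hu hp hall using hex
  have hu0 {w : F} (hw : w ^ (q + 1) = 1) : u w ≠ 0 := right_ne_zero_of_mul (hp w hw).ne_zero
  have hα0 {w : F} (hw : w ^ (q + 1) = 1) : α w ≠ 0 := left_ne_zero_of_mul (hp w hw).ne_zero
  have hv {w : F} (hw : w ^ (q + 1) = 1) : (u w * w) ^ (q + 1) = 1 := by
    rw [mul_pow, hu w hw, hw, one_mul]
  set f : F → F × F × F := fun w => (α w, u w, u w * w) with hfdef
  have hG (t : F × F × F) : t ∈ (Set.toFinite {w : F | w ^ (q + 1) = 1}).toFinset.image f ↔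
      ∃ w, w ^ (q + 1) = 1 ∧ f w = t := by
    simp only [Finset.mem_image, Set.Finite.mem_toFinset, Set.mem_ofPred_eq]
  refine ⟨(Set.toFinite {w : F | w ^ (q + 1) = 1}).toFinset.image f, ⟨?_, ?_, ?_⟩, ?_⟩
  · rw [Finset.card_image_of_injOn, ← Set.ncard_eq_toFinset_card, hf.ncard_norm_one]
    intro w hw w' hw' h
    simp only [Set.Finite.coe_toFinset, Set.mem_ofPred_eq] at hw hw'
    simp only [hfdef, Prod.mk.injEq] at h
    obtain ⟨-, h1, h2⟩ := h
    rw [← h1] at h2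
    exact mul_left_cancel₀ (hu0 hw) h2
  · intro t ht
    obtain ⟨w, hw, rfl⟩ := (hG t).1 ht
    exact ⟨hα w hw, hu w hw, hv hw⟩
  · intro t ht t' ht' hne
    obtain ⟨w, hw, rfl⟩ := (hG t).1 ht
    obtain ⟨w', hw', rfl⟩ := (hG t').1 ht'
    have hww : w ≠ w' := fun h => hne (by rw [h])
    simp only [hfdef]
    constructor
    · have : u w * (u w' * w') - u w' * (u w * w) = u w * u w' * (w' - w) := by ring
      rw [this]
      exact mul_ne_zero (mul_ne_zero (hu0 hw) (hu0 hw')) (sub_ne_zero.2 hww.symm)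
    · intro h
      obtain ⟨z, z', m, hm, hm'⟩ := exists_common_line hf (hp w hw) (hp w' hw') (by
        simp only [mul_assoc]
        simp only [mul_assoc] at h
        linear_combination h)
      have he := hpar.eq_of_mem (hall w hw z) (hall w' hw' z') hm hm'
      obtain ⟨d, hd, hdw⟩ := hf.exists_eq_mul_pow hw
      have hmem : secLine q d z ∈ hallSpread q (hallLine q (α w * u w) w z) :=
        Or.inr (secLine_mem_Ropp hf (hp w hw) z hd hdw)
      rw [he] at hmem
      exact hww (dir_eq_of_secLine_mem hf (hp w' hw') hd hdw hmem)
  · ext S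
    rw [mem_ParP_iff hf hη (fun t ht => by
      obtain ⟨w, hw, rfl⟩ := (hG t).1 ht
      exact ⟨hα0 hw, hu w hw, hv hw⟩)]
    constructor
    · intro hS
      by_cases hSD : S = Dspread q F 1
      · exact Or.inr hSD
      · left
        obtain ⟨c, w, z, hcw, rfl⟩ := hHall S hS hSD
        have hw := hcw.norm_dir
        obtain ⟨d, hd, hdw⟩ := hf.exists_eq_mul_pow hw
        refine ⟨f w, (hG _).2 ⟨w, hw, rfl⟩, z, ?_⟩
        simp only [hfdef, mul_div_cancel_left₀ _ (hu0 hw)]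
        exact hpar.eq_of_mem hS (hall w hw z) (Or.inr (secLine_mem_Ropp hf hcw z hd hdw))
          (Or.inr (secLine_mem_Ropp hf (hp w hw) z hd hdw))
    · rintro (⟨t, ht, z, rfl⟩ | rfl)
      · obtain ⟨w, hw, rfl⟩ := (hG t).1 ht
        simp only [hfdef, mul_div_cancel_left₀ _ (hu0 hw)]
        exact hall w hw z
      · exact hD

end Assembly

/-- Every parallelism of `Σ_η` consisting of `D_η` and Hall spreads obtained by switching
reguli of `D_η` through `r_{U₁} ∩ Σ_η`, invariant under all `g_b`, arises from a good set. -/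
theorem statement11 (q : ℕ) (hq : IsPrimePow q) (hq3 : 3 ≤ q) (F : Type) [Field F] [Fintype F]
    (hF : Fintype.card F = q ^ 2) (I : Set F) (hI : IsIndexSet q F I)
    (η : F) (hηU : η ^ (q + 1) = 1)
    (Pl : Set (Set (Set (Pt F))))
    (hpar : IsParallelismOfSigma q F η Pl)
    (hD : Dspread q F η ∈ Pl)
    (hHall : ∀ S ∈ Pl, S ≠ Dspread q F η →
      ∃ ℓ : Set (Pt F), isLine F ℓ ∧ ℓ ∩ (tau q F η '' ℓ) = ∅ ∧ ℓ ∩ SigmaSet q F η = ∅ ∧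
        IsRegulusOfSigma q F η (Rreg q F η ℓ) ∧
        rU1 F ∩ SigmaSet q F η ∈ Rreg q F η ℓ ∧
        S = (Sspread q F η ℓ \ Rreg q F η ℓ) ∪ Ropp q F η ℓ)
    (hinv : ∀ b : F,
      (fun S : Set (Set (Pt F)) => (fun m : Set (Pt F) => gmap q F b '' m) '' S) '' Pl = Pl) :
    ∃ G : Finset (F × F × F), IsGoodSet q F I G ∧ Pl = ParP q F η G := by
  have hf := qFrob_of_card hq hF
  rw [isParallelismOfSigma_eq hf hηU] at hpar
  rw [dspread_eq hf hηU] at hD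
  simp only [dspread_eq hf hηU, sspread_eq hf hηU, rreg_eq hf hηU, ropp_eq hf hηU,
    sigmaSet_eq hf hηU, tau_eq hηU, rU1_inter hf] at hHall
  refine exists_isGoodSet hf hI hηU hpar hD (fun S hS hSD => ?_) hinv
  obtain ⟨ℓ, hℓ, hdisj, -, -, hr, rfl⟩ := hHall S hS hSD
  obtain ⟨c, w, z, hp, rfl⟩ := exists_eq_hallLine hf hℓ hdisj hr (hpar.1 _ hS)
  exact ⟨c, w, z, hp, rfl⟩
end

section
/- Let q be a prime power, I an index set, and let 𝒫 be a set of q+1 triples (α,u,v) ∈ I × U × U. Then 𝒫 is a good set if and only if both of the following hold: for every c ∈ U there is exactly one triple (α,u,v) ∈ 𝒫 with u = c v, and for every b ∈ U there is exactly one triple (α,u,v) ∈ 𝒫 with α² u v = α^{q+1} b. -/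
noncomputable section

variable (q : ℕ) (F : Type) [Field F]

/-- `a` is a square of an element of the subfield `F_q`. -/
def IsSqFq (a : F) : Prop := ∃ x : F, x ^ q = x ∧ x ^ 2 = a

end

/-- A map from a set of `q + 1` elements to `U` is injective iff it takes every value exactly
once. -/
theorem injOn_iff_existsUnique_of_mapsTo_Uset {T : Type*} {q : ℕ} {F : Type} [Field F]
    (G : Finset T) (hcard : G.card = q + 1) (f : T → F) (hf : ∀ t ∈ G, f t ∈ Uset q F) :
    Set.InjOn f G ↔ ∀ b ∈ Uset q F, ∃! t : T, t ∈ G ∧ f t = b := by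
  classical
  have hU : ∀ b : F, b ∈ (Polynomial.nthRoots (q + 1) (1 : F)).toFinset ↔ b ∈ Uset q F := by
    intro b
    simp [Polynomial.mem_nthRoots, Uset]
  constructor
  · intro h b hb
    have hle : (Polynomial.nthRoots (q + 1) (1 : F)).toFinset.card ≤ G.card :=
      hcard ▸ (Multiset.toFinset_card_le _).trans (Polynomial.card_nthRoots _ _)
    obtain ⟨t, ht, hbt⟩ := Finset.surjOn_of_injOn_of_card_le f
      (fun t ht => (hU _).2 (hf t ht)) h hle ((hU b).2 hb)
    exact ⟨t, ⟨ht, hbt⟩, fun t' ht' => h ht'.1 ht (ht'.2.trans hbt.symm)⟩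
  · intro h t ht t' ht' hEq
    exact (h _ (hf t ht)).unique ⟨ht, rfl⟩ ⟨ht', hEq.symm⟩

theorem ne_zero_of_mem_Uset {q : ℕ} {F : Type} [Field F] {u : F} (hu : u ∈ Uset q F) :
    u ≠ 0 := by
  rintro rfl
  simp [Uset] at hu

theorem pow_eq_inv_of_mem_Uset {q : ℕ} {F : Type} [Field F] {u : F} (hu : u ∈ Uset q F) :
    u ^ q = u⁻¹ :=
  eq_inv_of_mul_eq_one_left ((pow_succ u q).symm.trans hu)

theorem mul_mem_Uset {q : ℕ} {F : Type} [Field F] {u v : F} (hu : u ∈ Uset q F)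
    (hv : v ∈ Uset q F) : u * v ∈ Uset q F := by
  simp only [Uset, Set.mem_ofPred_eq] at *
  rw [mul_pow, hu, hv, one_mul]

theorem div_mem_Uset {q : ℕ} {F : Type} [Field F] {u v : F} (hu : u ∈ Uset q F)
    (hv : v ∈ Uset q F) : u / v ∈ Uset q F := by
  simp only [Uset, Set.mem_ofPred_eq] at *
  rw [div_pow, hu, hv, div_one]

theorem div_pow_mem_Uset {q : ℕ} {F : Type} [Field F] [Fintype F]
    (hF : Fintype.card F = q ^ 2) {a : F} (ha : a ≠ 0) : a / a ^ q ∈ Uset q F := by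
  have h : (a ^ q) ^ q = a := by
    rw [← pow_mul, ← sq, ← hF, FiniteField.pow_card]
  have haq : a ^ q ≠ 0 := pow_ne_zero _ ha
  change (a / a ^ q) ^ (q + 1) = 1
  rw [div_pow, pow_succ (a ^ q), h, pow_succ, mul_comm, div_self (mul_ne_zero ha haq)]


/-- A set of `q+1` triples is a good set iff it meets every "line" `u = c v` and every
"union of conics" `α² u v = α^{q+1} b` exactly once. -/
theorem statement12 (q : ℕ) (hq : IsPrimePow q) (F : Type) [Field F] [Fintype F]
    (hF : Fintype.card F = q ^ 2) (I : Set F) (hI : IsIndexSet q F I)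
    (G : Finset (F × F × F)) (hcard : G.card = q + 1)
    (hmem : ∀ t ∈ G, t.1 ∈ I ∧ t.2.1 ∈ Uset q F ∧ t.2.2 ∈ Uset q F) :
    IsGoodSet q F I G ↔
      ((∀ c ∈ Uset q F, ∃! t : F × F × F, t ∈ G ∧ t.2.1 = c * t.2.2) ∧
        (∀ b ∈ Uset q F, ∃! t : F × F × F, t ∈ G ∧
          t.1 ^ 2 * t.2.1 * t.2.2 = t.1 ^ (q + 1) * b)) := by
  have key : ∀ t ∈ G, t.1 ≠ 0 ∧ t.2.1 ≠ 0 ∧ t.2.2 ≠ 0 := fun t ht =>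
    ⟨fun h => hI.1 (h ▸ (hmem t ht).1), ne_zero_of_mem_Uset (hmem t ht).2.1,
      ne_zero_of_mem_Uset (hmem t ht).2.2⟩
  have hf := injOn_iff_existsUnique_of_mapsTo_Uset G hcard (fun t => t.2.1 / t.2.2)
    fun t ht => div_mem_Uset (hmem t ht).2.1 (hmem t ht).2.2
  have hg := injOn_iff_existsUnique_of_mapsTo_Uset G hcard
    (fun t => t.1 / t.1 ^ q * (t.2.1 * t.2.2))
    fun t ht => mul_mem_Uset (div_pow_mem_Uset hF (key t ht).1)
      (mul_mem_Uset (hmem t ht).2.1 (hmem t ht).2.2)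
  have line (c : F) (t : F × F × F) :
      (t ∈ G ∧ t.2.1 = c * t.2.2) ↔ (t ∈ G ∧ t.2.1 / t.2.2 = c) :=
    and_congr_right fun ht => (div_eq_iff (key t ht).2.2).symm
  have conic (b : F) (t : F × F × F) :
      (t ∈ G ∧ t.1 ^ 2 * t.2.1 * t.2.2 = t.1 ^ (q + 1) * b) ↔
        (t ∈ G ∧ t.1 / t.1 ^ q * (t.2.1 * t.2.2) = b) := by
    refine and_congr_right fun ht => ?_
    have ha := (key t ht).1
    have haq : t.1 ^ q ≠ 0 := pow_ne_zero _ ha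
    rw [div_mul_eq_mul_div, div_eq_iff haq,
      ← mul_right_inj' (b := t.1 * (t.2.1 * t.2.2)) ha]
    ring_nf
  simp only [line, conic]
  rw [← hf, ← hg]
  have first : ∀ t ∈ G, ∀ t' ∈ G,
      (t.2.1 * t'.2.2 - t'.2.1 * t.2.2 = 0 ↔ t.2.1 / t.2.2 = t'.2.1 / t'.2.2) :=
    fun t ht t' ht' => by
      rw [sub_eq_zero, div_eq_div_iff (key t ht).2.2 (key t' ht').2.2]
  have second : ∀ t ∈ G, ∀ t' ∈ G,
      (t.1 * t.2.1 * (t'.1 * t'.2.2) ^ q - (t.1 * t.2.2) ^ q * (t'.1 * t'.2.1) = 0 ↔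
        t.1 / t.1 ^ q * (t.2.1 * t.2.2) = t'.1 / t'.1 ^ q * (t'.2.1 * t'.2.2)) := by
    intro t ht t' ht'
    have haq : t.1 ^ q ≠ 0 := pow_ne_zero _ (key t ht).1
    have haq' : t'.1 ^ q ≠ 0 := pow_ne_zero _ (key t' ht').1
    have hv := (key t ht).2.2
    have hv' := (key t' ht').2.2
    rw [sub_eq_zero, mul_pow, mul_pow, pow_eq_inv_of_mem_Uset (hmem t ht).2.2,
      pow_eq_inv_of_mem_Uset (hmem t' ht').2.2, div_mul_eq_mul_div, div_mul_eq_mul_div,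
      div_eq_div_iff haq haq', ← mul_left_inj' (mul_ne_zero hv hv')]
    have e : t.1 * t.2.1 * (t'.1 ^ q * t'.2.2⁻¹) * (t.2.2 * t'.2.2) =
        t.1 * (t.2.1 * t.2.2) * t'.1 ^ q := by
      linear_combination t.1 * t.2.1 * t'.1 ^ q * t.2.2 * inv_mul_cancel₀ hv'
    have e' : t.1 ^ q * t.2.2⁻¹ * (t'.1 * t'.2.1) * (t.2.2 * t'.2.2) =
        t'.1 * (t'.2.1 * t'.2.2) * t.1 ^ q := by
      linear_combination t.1 ^ q * t'.1 * t'.2.1 * t'.2.2 * inv_mul_cancel₀ hv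
    rw [e, e']
  constructor
  · rintro ⟨-, -, h⟩
    refine ⟨fun t ht t' ht' hEq => ?_, fun t ht t' ht' hEq => ?_⟩ <;> by_contra hne
    · exact (h t ht t' ht' hne).1 ((first t ht t' ht').2 hEq)
    · exact (h t ht t' ht' hne).2 ((second t ht t' ht').2 hEq)
  · rintro ⟨h₁, h₂⟩
    exact ⟨hcard, hmem, fun t ht t' ht' hne =>
      ⟨fun h => hne (h₁ ht ht' ((first t ht t' ht').1 h)),
        fun h => hne (h₂ ht ht' ((second t ht t' ht').1 h))⟩⟩
end

section
/- Let q be a prime power, I an index set, and fix b, c ∈ U. Let M be the number of triples (α,u,v) ∈ I × U × U with u = c v and α^{q+1} b = α² u v. If q is even, then M = |I| = (q−2)/2. If q is odd, then M = 2|I₁| if (cb)^{(q+1)/2} = 1 and M = 2|I₂| if (cb)^{(q+1)/2} = −1, where I₁ := { α ∈ I : α^{q+1} is a square in F_q } and I₂ := I \ I₁. -/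
/-- The set of triples `(α, u, v) ∈ I × U × U` with `u = c v` and `α^{q+1} b = α² u v`. -/
def MCount (q : ℕ) (F : Type) [Field F] (I : Set F) (b c : F) : Set (F × F × F) :=
  {t : F × F × F | t.1 ∈ I ∧ t.2.1 ∈ Uset q F ∧ t.2.2 ∈ Uset q F ∧
    t.2.1 = c * t.2.2 ∧ t.1 ^ (q + 1) * b = t.1 ^ 2 * t.2.1 * t.2.2}

theorem card_div_two_eq {q : ℕ} {F : Type*} [Fintype F] (hF : Fintype.card F = q ^ 2)
    (ho : Odd q) :
    Fintype.card F / 2 = (q - 1) * ((q + 1) / 2) ∧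
      Fintype.card F / 2 = (q + 1) * ((q - 1) / 2) := by
  obtain ⟨k, rfl⟩ := ho
  have h1 : (2 * k + 1) ^ 2 / 2 = 2 * k * (k + 1) := by
    rw [show (2 * k + 1) ^ 2 = 2 * (2 * k * (k + 1)) + 1 by ring]
    omega
  rw [hF, h1, show (2 * k + 1 + 1) / 2 = k + 1 by omega, show 2 * k + 1 - 1 = 2 * k by omega,
    show 2 * k / 2 = k by omega]
  exact ⟨rfl, by ring⟩

section

variable {q : ℕ} {F : Type} [Field F] {I : Set F} {b c : F}

/-- A field with `q ^ 2` elements has exactly `q - 1` nonzero elements fixed by `x ↦ x ^ q`. -/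
theorem ncard_FqSet_diff_zero [Fintype F] (hq : 1 < q) (hF : Fintype.card F = q ^ 2) :
    (FqSet q F \ {0}).ncard = q - 1 := by
  classical
  obtain ⟨g, hg⟩ := IsCyclic.exists_generator (α := Fˣ)
  have hord : orderOf g = (q + 1) * (q - 1) := by
    rw [orderOf_eq_card_of_forall_mem_zpowers hg, Nat.card_eq_fintype_card, Fintype.card_units, hF]
    simpa using Nat.sq_sub_sq q 1
  have hprim : IsPrimitiveRoot (g : F) ((q + 1) * (q - 1)) :=
    IsPrimitiveRoot.coe_units_iff.2 (hord ▸ IsPrimitiveRoot.orderOf g)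
  have hpos : 0 < q - 1 := by omega
  have hprim' := hprim.pow (by positivity) rfl
  rw [← hprim'.card_nthRootsFinset, ← Set.ncard_coe_finset]
  congr 1
  ext x
  rw [Finset.mem_coe, Polynomial.mem_nthRootsFinset hpos]
  simp only [FqSet, Set.mem_sdiff, Set.mem_ofPred_eq, Set.mem_singleton_iff]
  obtain ⟨n, rfl⟩ : ∃ n, q = n + 1 := ⟨q - 1, by omega⟩
  simp only [Nat.add_sub_cancel] at hpos ⊢
  rw [pow_succ]
  constructor
  · rintro ⟨h, h0⟩
    exact (mul_eq_right₀ h0).1 h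
  · intro h
    refine ⟨by rw [h, one_mul], ?_⟩
    rintro rfl
    simp [hpos.ne'] at h

theorem IsIndexSet.ncard_eq_of_even [Fintype F] (hI : IsIndexSet q F I) (hq : 1 < q)
    (hF : Fintype.card F = q ^ 2) (he : Even q) : I.ncard = (q - 2) / 2 := by
  obtain ⟨-, hinj, -, h1, hun, hev, -⟩ := hI
  have hcard := ncard_FqSet_diff_zero hq hF
  have hdisj : Disjoint (normIm q F I ∪ Inv.inv '' normIm q F I) {1} := by
    rw [Set.disjoint_singleton_right]
    rintro (h | ⟨x, hx, hx1⟩)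
    · exact h1 h
    · rw [inv_eq_one.1 hx1] at hx
      exact h1 hx
  rw [← hun, Set.ncard_union_eq hdisj,
    Set.ncard_union_eq (Set.disjoint_iff_inter_eq_empty.2 (hev he)),
    Set.ncard_image_of_injective _ inv_injective, normIm, hinj.ncard_image,
    Set.ncard_singleton] at hcard
  omega

theorem mk_mem_MCount_iff (hI : IsIndexSet q F I) (hq : 1 < q) (hc : c ∈ Uset q F) {α u v : F} :
    (α, u, v) ∈ MCount q F I b c ↔
      α ∈ I ∧ v ∈ Uset q F ∧ u = c * v ∧ v ^ 2 = α ^ (q - 1) * b * c⁻¹ := by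
  have hc' : c ^ (q + 1) = 1 := hc
  have hc0 : c ≠ 0 := by
    rintro rfl
    simp at hc'
  simp only [MCount, Uset, Set.mem_ofPred_eq]
  have key : α ∈ I → u = c * v →
      (α ^ (q + 1) * b = α ^ 2 * u * v ↔ v ^ 2 = α ^ (q - 1) * b * c⁻¹) := by
    rintro hα rfl
    have hα0 : α ≠ 0 := fun h => hI.1 (h ▸ hα)
    rw [show q + 1 = 2 + (q - 1) by omega, pow_add, eq_mul_inv_iff_mul_eq₀ hc0,
      show α ^ 2 * (c * v) * v = α ^ 2 * (v ^ 2 * c) by ring, mul_assoc,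
      mul_right_inj' (pow_ne_zero 2 hα0), eq_comm]
  constructor
  · rintro ⟨hα, -, hv, hu, h⟩
    exact ⟨hα, hv, hu, (key hα hu).1 h⟩
  · rintro ⟨hα, hv, rfl, h⟩
    exact ⟨hα, by rw [mul_pow, hc', hv, one_mul], hv, rfl, (key hα rfl).2 h⟩

theorem pow_sub_one_mul_mul_inv_mem_Uset [Fintype F] (hF : Fintype.card F = q ^ 2)
    (hb : b ∈ Uset q F) (hc : c ∈ Uset q F) {α : F} (hα : α ≠ 0) :
    α ^ (q - 1) * b * c⁻¹ ∈ Uset q F := by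
  have h : (q - 1) * (q + 1) = Fintype.card F - 1 := by
    rw [hF, mul_comm]
    simpa using (Nat.sq_sub_sq q 1).symm
  simp only [Uset, Set.mem_ofPred_eq] at *
  rw [mul_pow, mul_pow, hb, inv_pow, hc, ← pow_mul, h, FiniteField.pow_card_sub_one_eq_one α hα]
  simp

theorem ncard_MCount_of_even [Fintype F] (hI : IsIndexSet q F I) (hq : 1 < q)
    (hF : Fintype.card F = q ^ 2) (he : Even q) (hb : b ∈ Uset q F) (hc : c ∈ Uset q F) :
    (MCount q F I b c).ncard = I.ncard := by
  have h2 : ringChar F = 2 := by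
    rw [FiniteField.even_card_iff_char_two, hF, ← Nat.even_iff]
    exact he.pow_of_ne_zero two_ne_zero
  have : CharP F 2 := ringChar.of_eq h2
  have hinj : Set.InjOn Prod.fst (MCount q F I b c) := by
    rintro ⟨α, u, v⟩ h ⟨α', u', v'⟩ h' (rfl : α = α')
    rw [mk_mem_MCount_iff hI hq hc] at h h'
    obtain ⟨-, -, rfl, hv⟩ := h
    obtain ⟨-, -, rfl, hv'⟩ := h'
    rw [CharTwo.sq_injective (hv.trans hv'.symm)]
  rw [← hinj.ncard_image]
  congr 1
  ext α
  constructor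
  · rintro ⟨t, ht, rfl⟩
    exact ht.1
  · intro hα
    have hw := pow_sub_one_mul_mul_inv_mem_Uset hF hb hc (fun h => hI.1 (h ▸ hα) : α ≠ 0)
    obtain ⟨v, hv⟩ := (FiniteField.isSquare_of_char_two h2 (α ^ (q - 1) * b * c⁻¹))
    rw [← sq] at hv
    refine ⟨(α, c * v, v), (mk_mem_MCount_iff hI hq hc).2 ⟨hα, ?_, rfl, hv.symm⟩, rfl⟩
    refine CharTwo.sq_injective (?_ : (v ^ (q + 1)) ^ 2 = 1 ^ 2)
    rw [← pow_mul, mul_comm, pow_mul, ← hv, one_pow]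
    exact hw

theorem ringChar_ne_two_of_odd [Fintype F] (hF : Fintype.card F = q ^ 2) (ho : Odd q) :
    ringChar F ≠ 2 := by
  rw [Ne, FiniteField.even_card_iff_char_two, hF, ← Nat.even_iff, Nat.not_even_iff_odd]
  exact ho.pow

/-- In `U`, the squares are the roots of `w ^ ((q + 1) / 2) = 1`. -/
theorem exists_mem_Uset_sq_eq_iff [Fintype F] (hF : Fintype.card F = q ^ 2) (ho : Odd q) {w : F}
    (hw : w ∈ Uset q F) : (∃ v ∈ Uset q F, v ^ 2 = w) ↔ w ^ ((q + 1) / 2) = 1 := by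
  have hhalf : 2 * ((q + 1) / 2) = q + 1 := Nat.two_mul_div_two_of_even ho.add_one
  constructor
  · rintro ⟨v, hv, rfl⟩
    rw [← pow_mul, hhalf]
    exact hv
  · intro h
    have hw0 : w ≠ 0 := by
      rintro rfl
      simp [Uset] at hw
    obtain ⟨v, rfl⟩ := (FiniteField.isSquare_iff (ringChar_ne_two_of_odd hF ho) hw0).2 (by
      rw [(card_div_two_eq hF ho).1, mul_comm, pow_mul, h, one_pow])
    refine ⟨v, ?_, sq v⟩
    rw [← sq, ← pow_mul, hhalf] at h
    exact h

theorem isSqFq_norm_iff [Fintype F] (hq : 1 < q) (hF : Fintype.card F = q ^ 2) (ho : Odd q)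
    {α : F} (hα : α ≠ 0) : IsSqFq q F (α ^ (q + 1)) ↔ α ^ (Fintype.card F / 2) = 1 := by
  constructor
  · rintro ⟨x, hx, hxα⟩
    have hx0 : x ≠ 0 := by
      rintro rfl
      exact pow_ne_zero (q + 1) hα (by rw [← hxα]; simp)
    rw [(card_div_two_eq hF ho).2, pow_mul, ← hxα, ← pow_mul,
      Nat.two_mul_div_two_of_even (Nat.Odd.sub_odd ho odd_one)]
    refine (mul_eq_right₀ hx0).1 ?_
    rw [← pow_succ, Nat.sub_add_cancel hq.le, hx]
  · intro h
    obtain ⟨s, rfl⟩ := (FiniteField.isSquare_iff (ringChar_ne_two_of_odd hF ho) hα).2 h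
    refine ⟨s ^ (q + 1), ?_, by rw [mul_pow, sq]⟩
    rw [← pow_mul, add_mul, one_mul, ← sq, pow_add, ← hF, FiniteField.pow_card, ← pow_succ']

/-- For odd `q` every first coordinate that occurs in the triples occurs exactly twice. -/
theorem ncard_MCount_of_odd [Fintype F] (hI : IsIndexSet q F I) (hq : 1 < q)
    (hF : Fintype.card F = q ^ 2) (ho : Odd q) (hb : b ∈ Uset q F) (hc : c ∈ Uset q F) :
    (MCount q F I b c).ncard =
      2 * {α ∈ I | α ^ (Fintype.card F / 2) * (c * b) ^ ((q + 1) / 2) = 1}.ncard := by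
  have hneg := Ring.neg_one_ne_one_of_char_ne_two (ringChar_ne_two_of_odd hF ho)
  have hpow (α : F) : (α ^ (q - 1) * b * c⁻¹) ^ ((q + 1) / 2) =
      α ^ (Fintype.card F / 2) * (c * b) ^ ((q + 1) / 2) := by
    have hcc : c⁻¹ ^ ((q + 1) / 2) = c ^ ((q + 1) / 2) := by
      rw [inv_pow]
      refine inv_eq_of_mul_eq_one_left ?_
      rw [← pow_add, ← two_mul, Nat.two_mul_div_two_of_even ho.add_one]
      exact hc
    rw [(card_div_two_eq hF ho).1, mul_pow, mul_pow, hcc, mul_pow, pow_mul]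
    ring
  set S := {α ∈ I | α ^ (Fintype.card F / 2) * (c * b) ^ ((q + 1) / 2) = 1} with hS
  have hroot : ∀ α ∈ I, α ∈ S ↔ ∃ v ∈ Uset q F, v ^ 2 = α ^ (q - 1) * b * c⁻¹ := by
    intro α hα
    rw [exists_mem_Uset_sq_eq_iff hF ho (pow_sub_one_mul_mul_inv_mem_Uset hF hb hc
      (fun h => hI.1 (h ▸ hα))), hpow, hS, Set.mem_ofPred_eq, and_iff_right hα]
  choose! r hrU hr using fun α (hα : α ∈ S) => (hroot α hα.1).1 hα
  have hfst {f : F → F × F} : Function.Injective fun α => (α, f α) :=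
    fun _ _ h => (Prod.ext_iff.1 h).1
  have hunion : MCount q F I b c =
      (fun α => (α, c * r α, r α)) '' S ∪ (fun α => (α, c * -r α, -r α)) '' S := by
    ext ⟨α, u, v⟩
    rw [mk_mem_MCount_iff hI hq hc]
    constructor
    · rintro ⟨hα, hv, rfl, h⟩
      have hαS := (hroot α hα).2 ⟨v, hv, h⟩
      rcases sq_eq_sq_iff_eq_or_eq_neg.1 (h.trans (hr α hαS).symm) with rfl | rfl
      · exact Or.inl ⟨α, hαS, rfl⟩
      · exact Or.inr ⟨α, hαS, rfl⟩
    · rintro (⟨α', hα', h⟩ | ⟨α', hα', h⟩) <;> obtain ⟨rfl, rfl, rfl⟩ := by simpa using h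
      · exact ⟨hα'.1, hrU _ hα', rfl, hr _ hα'⟩
      · refine ⟨hα'.1, ?_, by ring, by rw [neg_sq, hr _ hα']⟩
        exact (ho.add_one.neg_pow _).trans (hrU _ hα')
  have hdisj : Disjoint ((fun α => (α, c * r α, r α)) '' S)
      ((fun α => (α, c * -r α, -r α)) '' S) := by
    rw [Set.disjoint_left]
    rintro _ ⟨α, hα, rfl⟩ ⟨α', -, h⟩
    obtain ⟨rfl, -, h⟩ : α' = α ∧ _ ∧ -r α' = r α := by simpa only [Prod.mk.injEq] using h
    have h0 : r α' ≠ 0 := by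
      intro h0
      have := hrU _ hα
      simp [Uset, h0] at this
    exact hneg (mul_right_cancel₀ h0 (by rw [neg_one_mul, h, one_mul]))
  rw [hunion, Set.ncard_union_eq hdisj, Set.ncard_image_of_injective _ hfst,
    Set.ncard_image_of_injective _ hfst, two_mul]

end

/-- Counting the triples `(α,u,v) ∈ I × U × U` with `u = c v` and `α^{q+1} b = α² u v`. -/
theorem statement15 (q : ℕ) (hq : IsPrimePow q) (F : Type) [Field F] [Fintype F]
    (hF : Fintype.card F = q ^ 2) (I : Set F) (hI : IsIndexSet q F I)
    (b c : F) (hb : b ∈ Uset q F) (hc : c ∈ Uset q F) :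
    (Even q →
      (MCount q F I b c).ncard = I.ncard ∧ I.ncard = (q - 2) / 2) ∧
    (Odd q →
      ((c * b) ^ ((q + 1) / 2) = 1 →
        (MCount q F I b c).ncard = 2 * {α ∈ I | IsSqFq q F (α ^ (q + 1))}.ncard) ∧
      ((c * b) ^ ((q + 1) / 2) = -1 →
        (MCount q F I b c).ncard
          = 2 * (I \ {α ∈ I | IsSqFq q F (α ^ (q + 1))}).ncard)) := by
  have hq1 := hq.one_lt
  refine ⟨fun he => ⟨ncard_MCount_of_even hI hq1 hF he hb hc, hI.ncard_eq_of_even hq1 hF he⟩,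
    fun ho => ⟨fun h => ?_, fun h => ?_⟩⟩
  · rw [ncard_MCount_of_odd hI hq1 hF ho hb hc, h]
    congr 2
    ext α
    simp only [Set.mem_ofPred_eq, mul_one]
    refine and_congr_right fun hα => (isSqFq_norm_iff hq1 hF ho ?_).symm
    exact fun h0 => hI.1 (h0 ▸ hα)
  · rw [ncard_MCount_of_odd hI hq1 hF ho hb hc, h]
    congr 2
    ext α
    simp only [Set.mem_sdiff, Set.mem_ofPred_eq, not_and]
    refine and_congr_right fun hα => ?_
    have hα0 : α ≠ 0 := fun h0 => hI.1 (h0 ▸ hα)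
    have hchar := ringChar_ne_two_of_odd hF ho
    have hneg := Ring.neg_one_ne_one_of_char_ne_two hchar
    rw [isSqFq_norm_iff hq1 hF ho hα0]
    rcases FiniteField.pow_dichotomy hchar hα0 with h1 | h1 <;> simp [h1, hneg, hα]
end
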